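/- arXiv:2503.19297 — 4 statements merged into one kernel-verified Lean document; each statement's English description precedes it below -/
import Mathlib

section
/- Let n ≥ 2, H < 0, and r₀ ∈ (0, arccot((−H)/(2n−1))). Then there exists a real number s∗ with 0 < s∗ < ∞ and a triple (r, θ, α) of continuously differentiable functions on [0, s∗] such that: (r, θ, α) solves the CMC profile ODE system on (0, s∗); (r(0), θ(0), α(0)) = (r₀, π/4, −π/2); (r(s), θ(s), α(s)) ∈ (0, π/2) × (0, π/4) × (−π/2, 0) for all s ∈ (0, s∗); α̇(s) > 0 for all s ∈ (0, s∗); θ(s∗) > 0; and at the endpoint one has r(s∗) = π/2 or α(s∗) = 0 or α̇(s∗) = 0. -/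
open Real Set

/-- The inverse cotangent, with values in `(0, π)`. -/
noncomputable def arccot (x : ℝ) : ℝ := Real.pi / 2 - Real.arctan x

/-- Right-hand side of the `α`-equation of the CMC profile ODE system:
`α̇ = (2n−2)·cot(2θ)·cos α / sin r − (2n−1)·cot r · sin α + H`. -/
noncomputable def alphaRHS (n : ℕ) (H rv θv αv : ℝ) : ℝ :=
  (2 * (n : ℝ) - 2) * (Real.cos (2 * θv) / Real.sin (2 * θv)) * Real.cos αv / Real.sin rv
    - (2 * (n : ℝ) - 1) * (Real.cos rv / Real.sin rv) * Real.sin αv + H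

/-- `(r, θ, α)` is a solution of the CMC profile ODE system on the set `I`:
the three functions are differentiable on `I`, `sin (r s) ≠ 0` and `sin (2 θ s) ≠ 0`
on `I`, and the equations `ṙ = cos α`, `θ̇ = sin α / sin r`,
`α̇ = (2n−2)·cot(2θ)·cos α / sin r − (2n−1)·cot r·sin α + H` hold at every `s ∈ I`. -/
def IsCMCSolutionOn (n : ℕ) (H : ℝ) (r θ α : ℝ → ℝ) (I : Set ℝ) : Prop :=
  ∀ s ∈ I,
    Real.sin (r s) ≠ 0 ∧ Real.sin (2 * θ s) ≠ 0 ∧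
    HasDerivWithinAt r (Real.cos (α s)) I s ∧
    HasDerivWithinAt θ (Real.sin (α s) / Real.sin (r s)) I s ∧
    HasDerivWithinAt α (alphaRHS n H (r s) (θ s) (α s)) I s

/-- A monotone (right-)maximal solution of the CMC profile ODE system on `(0, s∗)`
with initial value `r₀ ∈ (0, arccot((−H)/(2n−1)))`: a triple `(r, θ, α)` of `C¹`
functions on `[0, s∗]`, `0 < s∗ < ∞`, solving the system on `(0, s∗)`, with
`(r, θ, α)(0) = (r₀, π/4, −π/2)`, values in `(0, π/2) × (0, π/4) × (−π/2, 0)` on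
`(0, s∗)`, `α̇ > 0` on `(0, s∗)`, `θ(s∗) > 0`, and at the endpoint
`r(s∗) = π/2` or `α(s∗) = 0` or `α̇(s∗) = 0`. -/
structure IsMonotoneMaximalSolution (n : ℕ) (H : ℝ) (r θ α : ℝ → ℝ) (r₀ sStar : ℝ) : Prop where
  hsStar : 0 < sStar
  hr₀ : r₀ ∈ Ioo 0 (arccot (-H / (2 * (n : ℝ) - 1)))
  hC1r : ContDiffOn ℝ 1 r (Icc 0 sStar)
  hC1θ : ContDiffOn ℝ 1 θ (Icc 0 sStar)
  hC1α : ContDiffOn ℝ 1 α (Icc 0 sStar)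
  hsol : IsCMCSolutionOn n H r θ α (Ioo 0 sStar)
  hr0 : r 0 = r₀
  hθ0 : θ 0 = Real.pi / 4
  hα0 : α 0 = -(Real.pi / 2)
  hval : ∀ s ∈ Ioo 0 sStar,
    r s ∈ Ioo 0 (Real.pi / 2) ∧ θ s ∈ Ioo 0 (Real.pi / 4) ∧ α s ∈ Ioo (-(Real.pi / 2)) 0
  hαdot : ∀ s ∈ Ioo 0 sStar, 0 < derivWithin α (Icc 0 sStar) s
  hθend : 0 < θ sStar
  hend : r sStar = Real.pi / 2 ∨ α sStar = 0 ∨ derivWithin α (Icc 0 sStar) sStar = 0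


lemma mvt_ge {f f' : ℝ → ℝ} {a b C : ℝ} (hab : a ≤ b)
    (h : ∀ s ∈ Icc a b, HasDerivWithinAt f (f' s) (Icc a b) s)
    (hC : ∀ s ∈ Ioo a b, C ≤ f' s) : C * (b - a) ≤ f b - f a := by
  rcases hab.eq_or_lt with rfl | hlt
  · simp
  obtain ⟨c, hc, he⟩ := exists_hasDerivAt_eq_slope f f' hlt
    (fun s hs => (h s hs).continuousWithinAt)
    (fun s hs => (h s (Ioo_subset_Icc_self hs)).hasDerivAt (Icc_mem_nhds hs.1 hs.2))
  have := hC c hc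
  rw [he, le_div_iff₀ (by linarith)] at this
  exact this

lemma mvt_gt {f f' : ℝ → ℝ} {a b C : ℝ} (hlt : a < b)
    (h : ∀ s ∈ Icc a b, HasDerivWithinAt f (f' s) (Icc a b) s)
    (hC : ∀ s ∈ Ioo a b, C < f' s) : C * (b - a) < f b - f a := by
  obtain ⟨c, hc, he⟩ := exists_hasDerivAt_eq_slope f f' hlt
    (fun s hs => (h s hs).continuousWithinAt)
    (fun s hs => (h s (Ioo_subset_Icc_self hs)).hasDerivAt (Icc_mem_nhds hs.1 hs.2))
  have := hC c hc
  rw [he, lt_div_iff₀ (by linarith)] at this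
  exact this

lemma end_le {f : ℝ → ℝ} {τ c : ℝ} (hτ : 0 < τ) (hf : ContinuousOn f (Icc 0 τ))
    (h : ∀ s ∈ Ico 0 τ, f s ≤ c) : f τ ≤ c := by
  have hcl : τ ∈ closure (Ico 0 τ) := by
    rw [closure_Ico hτ.ne]; exact ⟨hτ.le, le_rfl⟩
  exact ContinuousWithinAt.closure_le hcl
    ((hf τ ⟨hτ.le, le_rfl⟩).mono Ico_subset_Icc_self) continuousWithinAt_const h

lemma end_ge {f : ℝ → ℝ} {τ c : ℝ} (hτ : 0 < τ) (hf : ContinuousOn f (Icc 0 τ))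
    (h : ∀ s ∈ Ico 0 τ, c ≤ f s) : c ≤ f τ := by
  have := end_le (c := -c) hτ hf.neg (fun s hs => neg_le_neg (h s hs))
  simpa using this

lemma cot_pos_aux (n : ℕ) (hn : 2 ≤ n) (H : ℝ) (hH : H < 0)
    (r₀ : ℝ) (hr₀ : r₀ ∈ Ioo 0 (arccot (-H / (2 * (n : ℝ) - 1)))) :
    r₀ < π / 2 ∧ 0 < (2 * (n : ℝ) - 1) * (cos r₀ / sin r₀) + H := by
  have hn' : (2 : ℝ) ≤ n := by exact_mod_cast hn
  have hB : 0 < 2 * (n : ℝ) - 1 := by linarith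
  obtain ⟨h0, h1⟩ := hr₀
  unfold arccot at h1
  have hx : 0 < -H / (2 * (n : ℝ) - 1) := div_pos (by linarith) hB
  have ha : 0 < arctan (-H / (2 * (n : ℝ) - 1)) := Real.arctan_pos.2 hx
  refine ⟨by linarith, ?_⟩
  have := Real.tan_lt_tan_of_lt_of_lt_pi_div_two (x := arctan (-H / (2 * (n : ℝ) - 1)))
    (y := π / 2 - r₀) (by linarith [pi_pos]) (by linarith) (by linarith)
  rw [tan_arctan, tan_pi_div_two_sub, tan_eq_sin_div_cos, inv_div, div_lt_iff₀ hB] at this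
  linarith

lemma apriori (n : ℕ) (hn : 2 ≤ n) (H : ℝ) (hH : H < 0)
    (r₀ : ℝ) (hr₀ : r₀ ∈ Ioo 0 (arccot (-H / (2 * (n : ℝ) - 1)))) :
    ∃ T > 0, ∃ ε > 0, ε < π / 4 ∧ ∀ (τ : ℝ) (r θ α : ℝ → ℝ), 0 < τ →
      (∀ s ∈ Icc 0 τ, HasDerivWithinAt r (cos (α s)) (Icc 0 τ) s) →
      (∀ s ∈ Icc 0 τ, HasDerivWithinAt θ (sin (α s) / sin (r s)) (Icc 0 τ) s) →
      (∀ s ∈ Icc 0 τ, HasDerivWithinAt α (alphaRHS n H (r s) (θ s) (α s)) (Icc 0 τ) s) →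
      r 0 = r₀ → θ 0 = π / 4 → α 0 = -(π / 2) →
      (∀ s ∈ Icc 0 τ, r s ∈ Icc r₀ (π / 2) ∧ 0 < θ s ∧ θ s ≤ π / 4 ∧
        α s ∈ Icc (-(π / 2)) 0 ∧ 0 ≤ alphaRHS n H (r s) (θ s) (α s)) →
      τ < T ∧ ε < θ τ := by
  obtain ⟨hr2, hcot⟩ := cot_pos_aux n hn H hH r₀ hr₀
  have hr0 : 0 < r₀ := hr₀.1
  have hn' : (2 : ℝ) ≤ n := by exact_mod_cast hn
  have hpi := pi_pos
  have hs0 : 0 < sin r₀ := sin_pos_of_pos_of_lt_pi hr0 (by linarith)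
  -- the constants
  obtain ⟨a, ha, δ, hδ, hδ1, hδ2, hab⟩ : ∃ a > 0, ∃ δ > 0, δ ≤ π / 2 ∧ δ / sin r₀ ≤ π / 8 ∧
      ∀ x ∈ Icc r₀ (r₀ + δ), ∀ b ∈ Icc 0 δ,
        a ≤ (2 * (n : ℝ) - 1) * (cos x / sin x) * cos b + H := by
    set c0 := (2 * (n : ℝ) - 1) * (cos r₀ / sin r₀) + H with hc0
    have hc : ContinuousAt (fun p : ℝ × ℝ =>
        (2 * (n : ℝ) - 1) * (cos p.1 / sin p.1) * cos p.2 + H) (r₀, 0) := by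
      have : sin ((r₀, (0 : ℝ)) : ℝ × ℝ).1 ≠ 0 := hs0.ne'
      fun_prop (disch := assumption)
    have hev := hc.eventually (lt_mem_nhds (a := c0 / 2) (by simp; linarith))
    obtain ⟨η, hη, hball⟩ := Metric.eventually_nhds_iff.1 hev
    refine ⟨c0 / 2, by linarith, min (η / 2) (min (π / 2) (π / 8 * sin r₀)), by positivity,
      (min_le_right _ _).trans (min_le_left _ _), ?_, ?_⟩
    · rw [div_le_iff₀ hs0]
      exact (min_le_right _ _).trans (min_le_right _ _)
    · intro x hx b hb
      have hm := min_le_left (η / 2) (min (π / 2) (π / 8 * sin r₀))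
      refine (hball (y := (x, b)) ?_).le
      rw [Prod.dist_eq, max_lt_iff, Real.dist_eq, Real.dist_eq, abs_lt, abs_lt]
      have := hx.1; have := hx.2; have := hb.1; have := hb.2
      refine ⟨⟨?_, ?_⟩, ?_, ?_⟩ <;> simp only [] <;> linarith
  set β := min δ (a * δ) with hβ
  have hβ0 : 0 < β := by positivity
  have hβ1 : β ≤ π / 2 := (min_le_left _ _).trans hδ1
  set c := sin β with hcdef
  have hc : 0 < c := sin_pos_of_pos_of_lt_pi hβ0 (by linarith)
  set T := δ + (π / 2) / c + 1 with hT
  have hTpos : 0 < T := by positivity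
  set k := (2 * (n : ℝ) - 2) * c * sin r₀ / 2 with hk
  have hk0 : 0 < k := by
    have : 0 < 2 * (n : ℝ) - 2 := by linarith
    positivity
  set η := exp ((k * log (sin (π / 4)) - π / 2 + H * T) / k) with hη
  have hη0 : 0 < η := exp_pos _
  refine ⟨T, hTpos, min (π / 16) (η / 4), by positivity,
    (min_le_left _ _).trans_lt (by linarith), ?_⟩
  intro τ r θ α hτ hr hθ hα hri hθi hαi hrng
  have hsub : ∀ {u v : ℝ}, 0 ≤ u → v ≤ τ → Icc u v ⊆ Icc 0 τ := fun hu hv =>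
    Icc_subset_Icc hu hv
  have mono_α : ∀ {u v : ℝ}, 0 ≤ u → u ≤ v → v ≤ τ → α u ≤ α v := by
    intro u v hu huv hv
    have := mvt_ge (C := 0) huv (fun s hs => (hα s (hsub hu hv hs)).mono (hsub hu hv))
      (fun s hs => (hrng s (hsub hu hv (Ioo_subset_Icc_self hs))).2.2.2.2)
    linarith
  have hsinr : ∀ s ∈ Icc 0 τ, sin r₀ ≤ sin (r s) := by
    intro s hs
    obtain ⟨⟨h1, h2⟩, -⟩ := hrng s hs
    exact sin_le_sin_of_le_of_le_pi_div_two (by linarith) h2 h1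
  have hθ8 : ∀ s ∈ Icc 0 τ, s ≤ δ → π / 8 ≤ θ s := by
    intro s hs hsδ
    have := mvt_ge (C := -(1 / sin r₀)) hs.1
      (fun u hu => (hθ u (hsub le_rfl hs.2 hu)).mono (hsub le_rfl hs.2))
      (fun u hu => by
        have h := hsinr u (hsub le_rfl hs.2 (Ioo_subset_Icc_self hu))
        have h3 : 0 < sin (r u) := hs0.trans_le h
        rw [le_div_iff₀ h3]
        have h1 : 1 ≤ 1 / sin r₀ * sin (r u) := by
          rw [one_div, inv_mul_eq_div, le_div_iff₀ hs0]; linarith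
        have := neg_one_le_sin (α u)
        linarith)
    have h2 : s / sin r₀ ≤ δ / sin r₀ := by gcongr
    have h3 : -(1 / sin r₀) * (s - 0) = -(s / sin r₀) := by ring
    rw [h3, hθi] at this
    linarith
  have hr1 : ∀ s ∈ Icc 0 τ, r s ≤ r₀ + s := by
    intro s hs
    have := mvt_ge (f := fun u => - r u) (C := -1) hs.1
      (fun u hu => ((hr u (hsub le_rfl hs.2 hu)).mono (hsub le_rfl hs.2)).neg)
      (fun u hu => neg_le_neg (cos_le_one _))
    simp only [hri] at this
    linarith
  have hε16 := min_le_left (π / 16) (η / 4)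
  have hε4 := min_le_right (π / 16) (η / 4)
  by_cases hτδ : τ ≤ δ
  · have hd : 0 ≤ (π / 2) / c := by positivity
    refine ⟨by linarith, ?_⟩
    have := hθ8 τ ⟨hτ.le, le_rfl⟩ hτδ
    linarith
  push Not at hτδ
  -- lower bound of the angle
  have hcot0 : ∀ s ∈ Icc 0 τ, 0 ≤ cos (2 * θ s) / sin (2 * θ s) := by
    intro s hs
    obtain ⟨-, h1, h2, -⟩ := hrng s hs
    exact div_nonneg (cos_nonneg_of_neg_pi_div_two_le_of_le (by linarith) (by linarith))
      (sin_nonneg_of_nonneg_of_le_pi (by linarith) (by linarith))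
  have hβδ : β ≤ α δ + π / 2 := by
    by_cases hd : δ ≤ α δ + π / 2
    · exact (min_le_left _ _).trans hd
    push Not at hd
    have := mvt_ge (C := a) hδ.le
      (fun u hu => (hα u (hsub le_rfl hτδ.le hu)).mono (hsub le_rfl hτδ.le))
      (fun u hu => by
        have hu' := hsub le_rfl hτδ.le (Ioo_subset_Icc_self hu)
        obtain ⟨⟨h1, h2⟩, h3, h4, ⟨h5, h6⟩, -⟩ := hrng u hu'
        have h7 := hr1 u hu'
        have h8 := mono_α hu.1.le hu.2.le hτδ.le
        have h9 := hab (r u) ⟨h1, by linarith [hu.2]⟩ (α u + π / 2) ⟨by linarith, by linarith⟩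
        rw [cos_add_pi_div_two] at h9
        have h10 : 0 < sin (r u) := hs0.trans_le (hsinr u hu')
        have h11 : 0 ≤ cos (α u) :=
          cos_nonneg_of_neg_pi_div_two_le_of_le (by linarith) (by linarith)
        have h12 : 0 ≤ (2 * (n : ℝ) - 2) * (cos (2 * θ u) / sin (2 * θ u)) * cos (α u)
            / sin (r u) :=
          div_nonneg (mul_nonneg (mul_nonneg (by linarith) (hcot0 u hu')) h11) h10.le
        unfold alphaRHS
        linarith)
    have h2 := min_le_right δ (a * δ)
    rw [hαi] at this
    linarith
  have hcos : ∀ s ∈ Icc δ τ, c ≤ cos (α s) := by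
    intro s hs
    have h1 := mono_α hδ.le hs.1 hs.2
    obtain ⟨-, -, -, ⟨h5, h6⟩, -⟩ := hrng s ⟨hδ.le.trans hs.1, hs.2⟩
    have : cos (α s) = sin (α s + π / 2) := by rw [sin_add_pi_div_two]
    rw [this]
    exact sin_le_sin_of_le_of_le_pi_div_two (by linarith) (by linarith) (by linarith)
  have hτT : τ < T := by
    have := mvt_ge (C := c) hτδ.le
      (fun u hu => (hr u (hsub hδ.le le_rfl hu)).mono (hsub hδ.le le_rfl))
      (fun u hu => hcos u (Ioo_subset_Icc_self hu))
    have h1 := (hrng τ ⟨hτ.le, le_rfl⟩).1.2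
    have h2 := (hrng δ ⟨hδ.le, hτδ.le⟩).1.1
    have h3 : τ - δ ≤ (π / 2) / c := by
      rw [le_div_iff₀ hc]; linarith
    linarith
  refine ⟨hτT, ?_⟩
  have hsin2 : ∀ s ∈ Icc 0 τ, 0 < sin (2 * θ s) := by
    intro s hs
    obtain ⟨-, h1, h2, -⟩ := hrng s hs
    exact sin_pos_of_pos_of_lt_pi (by linarith) (by linarith)
  have key := mvt_ge (f := fun s => α s + k * log (sin (2 * θ s)) - H * s) (C := 0) hτδ.le
    (fun u hu => by
      have hu' := hsub hδ.le le_rfl hu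
      have d1 := (hα u hu').mono (hsub hδ.le le_rfl)
      have d2 := (hθ u hu').mono (hsub hδ.le le_rfl)
      have d3 := ((d2.const_mul 2).sin.log (hsin2 u hu').ne').const_mul k
      exact (d1.add d3).sub ((hasDerivWithinAt_id u _).const_mul H))
    (fun u hu => by
      have hu1 := Ioo_subset_Icc_self hu
      have hu' := hsub hδ.le le_rfl hu1
      obtain ⟨⟨h1, h2⟩, h3, h4, ⟨h5, h6⟩, -⟩ := hrng u hu'
      have hs := hsinr u hu'
      have h10 : 0 < sin (r u) := hs0.trans_le hs
      have hq := hcot0 u hu'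
      set q := cos (2 * θ u) / sin (2 * θ u) with hqd
      have hcs := hcos u hu1
      have hA : 0 ≤ 2 * (n : ℝ) - 2 := by linarith
      have hsα : sin (α u) ≤ 0 := sin_nonpos_of_nonpos_of_neg_pi_le h6 (by linarith)
      have hcr : 0 ≤ cos (r u) :=
        cos_nonneg_of_neg_pi_div_two_le_of_le (by linarith) (by linarith)
      have e1 : 0 ≤ -((2 * (n : ℝ) - 1) * (cos (r u) / sin (r u)) * sin (α u)) := by
        rw [← mul_neg]
        exact mul_nonneg (mul_nonneg (by linarith) (div_nonneg hcr h10.le)) (by linarith)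
      have e2 : (2 * (n : ℝ) - 2) * q * c ≤ (2 * (n : ℝ) - 2) * q * cos (α u) / sin (r u) := by
        rw [le_div_iff₀ h10]
        have hm : 0 ≤ (2 * (n : ℝ) - 2) * q := mul_nonneg hA hq
        have := sin_le_one (r u)
        calc (2 * (n : ℝ) - 2) * q * c * sin (r u) ≤ (2 * (n : ℝ) - 2) * q * c * 1 := by
              gcongr
          _ ≤ (2 * (n : ℝ) - 2) * q * cos (α u) := by rw [mul_one]; gcongr
      have e3 : -(1 / sin r₀) ≤ sin (α u) / sin (r u) := by
        rw [le_div_iff₀ h10]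
        have h1 : 1 ≤ 1 / sin r₀ * sin (r u) := by
          rw [one_div, inv_mul_eq_div, le_div_iff₀ hs0]; linarith
        have := neg_one_le_sin (α u)
        linarith
      have e4 : k * (cos (2 * θ u) * (2 * (sin (α u) / sin (r u))) / sin (2 * θ u))
          = 2 * k * q * (sin (α u) / sin (r u)) := by
        rw [hqd]; ring
      have e5 : 2 * k * q * -(1 / sin r₀) ≤ 2 * k * q * (sin (α u) / sin (r u)) := by
        gcongr
      have e6 : 2 * k * q * -(1 / sin r₀) = -((2 * (n : ℝ) - 2) * q * c) := by
        rw [hk]; field_simp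
      rw [e4]
      unfold alphaRHS
      rw [← hqd]
      linarith)
  simp only [zero_mul] at key
  have b1 := (hrng τ ⟨hτ.le, le_rfl⟩).2.2.2.1.2
  have b2 := (hrng δ ⟨hδ.le, hτδ.le⟩).2.2.2.1.1
  have b3 : k * log (sin (π / 4)) ≤ k * log (sin (2 * θ δ)) := by
    have h1 := hθ8 δ ⟨hδ.le, hτδ.le⟩ le_rfl
    have h2 := (hrng δ ⟨hδ.le, hτδ.le⟩).2.2.1
    have h3 : 0 < sin (π / 4) := sin_pos_of_pos_of_lt_pi (by linarith) (by linarith)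
    have h4 : sin (π / 4) ≤ sin (2 * θ δ) :=
      sin_le_sin_of_le_of_le_pi_div_two (by linarith) (by linarith) (by linarith)
    gcongr
  have b4 : H * T ≤ H * τ - H * δ := by nlinarith
  have b5 : (k * log (sin (π / 4)) - π / 2 + H * T) / k ≤ log (sin (2 * θ τ)) := by
    rw [div_le_iff₀ hk0]; linarith
  have hs2 := hsin2 τ ⟨hτ.le, le_rfl⟩
  rw [Real.le_log_iff_exp_le hs2] at b5
  have b6 := sin_lt (x := 2 * θ τ) (by linarith [(hrng τ ⟨hτ.le, le_rfl⟩).2.1])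
  linarith

/-- clamp of `x` to the interval `[a, b]` -/
noncomputable def clampR (a b x : ℝ) : ℝ := max a (min b x)

lemma clampR_mem {a b : ℝ} (h : a ≤ b) (x : ℝ) : clampR a b x ∈ Icc a b :=
  ⟨le_max_left _ _, max_le h (min_le_left _ _)⟩

lemma clampR_eq {a b x : ℝ} (h : x ∈ Icc a b) : clampR a b x = x := by
  unfold clampR; rw [min_eq_right h.2, max_eq_right h.1]

lemma clampR_lip (a b : ℝ) : LipschitzWith 1 (clampR a b) :=
  (LipschitzWith.id.const_min b).const_max a

/-- the vector field -/
noncomputable def vfield (n : ℕ) (H : ℝ) (p : ℝ × ℝ × ℝ) : ℝ × ℝ × ℝ :=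
  (cos p.2.2, sin p.2.2 / sin p.1, alphaRHS n H p.1 p.2.1 p.2.2)

lemma exists_clamped (n : ℕ) (H r₀ ε T : ℝ) (hr0 : 0 < r₀) (hr2 : r₀ < π / 2) (hε : 0 < ε)
    (hε4 : ε < π / 4) (hT : 0 < T) :
    ∃ r θ α : ℝ → ℝ, r 0 = r₀ ∧ θ 0 = π / 4 ∧ α 0 = -(π / 2) ∧ ∀ s ∈ Icc 0 T,
      HasDerivWithinAt r (cos (clampR (-(π / 2)) 0 (α s))) (Icc 0 T) s ∧
      HasDerivWithinAt θ (sin (clampR (-(π / 2)) 0 (α s)) / sin (clampR r₀ (π / 2) (r s)))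
        (Icc 0 T) s ∧
      HasDerivWithinAt α (alphaRHS n H (clampR r₀ (π / 2) (r s)) (clampR ε (π / 4) (θ s))
        (clampR (-(π / 2)) 0 (α s))) (Icc 0 T) s := by
  have hpi := pi_pos
  set K : Set (ℝ × ℝ × ℝ) := Icc r₀ (π / 2) ×ˢ Icc ε (π / 4) ×ˢ Icc (-(π / 2)) 0 with hK
  have hKc : IsCompact K := isCompact_Icc.prod (isCompact_Icc.prod isCompact_Icc)
  have hKv : Convex ℝ K := (convex_Icc _ _).prod ((convex_Icc _ _).prod (convex_Icc _ _))
  have hs1 : ∀ p ∈ K, sin p.1 ≠ 0 := fun p hp =>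
    (sin_pos_of_pos_of_lt_pi (by linarith [hp.1.1]) (by linarith [hp.1.2])).ne'
  have hs2 : ∀ p ∈ K, sin (2 * p.2.1) ≠ 0 := fun p hp =>
    (sin_pos_of_pos_of_lt_pi (by linarith [hp.2.1.1]) (by linarith [hp.2.1.2])).ne'
  have hG : ContDiffOn ℝ 1 (vfield n H) K := by
    unfold vfield alphaRHS
    fun_prop (disch := assumption)
  obtain ⟨κ, hκ⟩ := hG.exists_lipschitzOnWith (by norm_num) hKv hKc
  set P : ℝ × ℝ × ℝ → ℝ × ℝ × ℝ := fun p =>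
    (clampR r₀ (π / 2) p.1, clampR ε (π / 4) p.2.1, clampR (-(π / 2)) 0 p.2.2) with hP
  have hPK : ∀ p, P p ∈ K := fun p =>
    ⟨clampR_mem hr2.le _, clampR_mem hε4.le _, clampR_mem (by linarith) _⟩
  have hPl : LipschitzWith 1 P := by
    have h1 := (clampR_lip r₀ (π / 2)).comp (LipschitzWith.prod_fst (α := ℝ) (β := ℝ × ℝ))
    have h2 := (clampR_lip ε (π / 4)).comp ((LipschitzWith.prod_fst (α := ℝ) (β := ℝ)).comp
      (LipschitzWith.prod_snd (α := ℝ) (β := ℝ × ℝ)))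
    have h3 := (clampR_lip (-(π / 2)) 0).comp ((LipschitzWith.prod_snd (α := ℝ) (β := ℝ)).comp
      (LipschitzWith.prod_snd (α := ℝ) (β := ℝ × ℝ)))
    simpa using h1.prodMk (h2.prodMk h3)
  obtain ⟨L, hL⟩ := hKc.exists_bound_of_continuousOn hG.continuousOn
  have hF : LipschitzWith κ (vfield n H ∘ P) := by
    have := hκ.comp (hPl.lipschitzOnWith (s := univ)) (fun p _ => hPK p)
    simpa using this
  have hL' : ∀ p, ‖(vfield n H ∘ P) p‖ ≤ L.toNNReal := fun p =>
    (hL _ (hPK p)).trans (Real.le_coe_toNNReal L)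
  have hPL : IsPicardLindelof (fun _ : ℝ => vfield n H ∘ P) (tmin := 0) (tmax := T)
      ⟨0, le_rfl, hT.le⟩ (r₀, π / 4, -(π / 2)) (L.toNNReal * T.toNNReal) 0 L.toNNReal κ :=
    { lipschitzOnWith := fun t _ => hF.lipschitzOnWith
      continuousOn := fun x _ => continuousOn_const
      norm_le := fun t _ x _ => hL' x
      mul_max_le := by
        simp [hT.le] }
  obtain ⟨x, hx0, hx⟩ := hPL.exists_eq_forall_mem_Icc_hasDerivWithinAt₀
  refine ⟨fun s => (x s).1, fun s => (x s).2.1, fun s => (x s).2.2, ?_, ?_, ?_, ?_⟩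
  · simpa using congrArg (fun p => p.1) hx0
  · simpa using congrArg (fun p => p.2.1) hx0
  · simpa using congrArg (fun p => p.2.2) hx0
  · intro s hs
    have h := (hx s hs)
    have hh := h.hasFDerivWithinAt
    refine ⟨?_, ?_, ?_⟩
    · simpa [vfield, hP] using hh.fst.hasDerivWithinAt
    · simpa [vfield, hP] using hh.snd.fst.hasDerivWithinAt
    · simpa [vfield, hP] using hh.snd.snd.hasDerivWithinAt

lemma c1_aux {f f' : ℝ → ℝ} {b : ℝ} (hb : 0 < b)
    (h : ∀ s ∈ Icc 0 b, HasDerivWithinAt f (f' s) (Icc 0 b) s)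
    (hc : ContinuousOn f' (Icc 0 b)) : ContDiffOn ℝ 1 f (Icc 0 b) := by
  rw [contDiffOn_one_iff_derivWithin (uniqueDiffOn_Icc hb)]
  refine ⟨fun s hs => (h s hs).differentiableWithinAt, hc.congr fun s hs => ?_⟩
  exact (h s hs).derivWithin (uniqueDiffOn_Icc hb s hs)

theorem exists_monotone_maximal_solution (n : ℕ) (hn : 2 ≤ n) (H : ℝ) (hH : H < 0)
    (r₀ : ℝ) (hr₀ : r₀ ∈ Ioo 0 (arccot (-H / (2 * (n : ℝ) - 1)))) :
    ∃ (sStar : ℝ) (r θ α : ℝ → ℝ),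
      IsMonotoneMaximalSolution n H r θ α r₀ sStar := by
  obtain ⟨hr2, hcot⟩ := cot_pos_aux n hn H hH r₀ hr₀
  have hr0 : 0 < r₀ := hr₀.1
  have hpi := pi_pos
  obtain ⟨T, hT, ε, hε, hε4, hap⟩ := apriori n hn H hH r₀ hr₀
  obtain ⟨r, θ, α, hri, hθi, hαi, hsolv⟩ := exists_clamped n H r₀ ε T hr0 hr2 hε hε4 hT
  set g : ℝ → ℝ := fun s => alphaRHS n H (clampR r₀ (π / 2) (r s)) (clampR ε (π / 4) (θ s))
        (clampR (-(π / 2)) 0 (α s)) with hg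
  have cr : ContinuousOn r (Icc 0 T) := fun s hs => (hsolv s hs).1.continuousWithinAt
  have cθ : ContinuousOn θ (Icc 0 T) := fun s hs => (hsolv s hs).2.1.continuousWithinAt
  have cα : ContinuousOn α (Icc 0 T) := fun s hs => (hsolv s hs).2.2.continuousWithinAt
  have hsr : ∀ x, 0 < sin (clampR r₀ (π / 2) x) := fun x => by
    have := clampR_mem hr2.le x
    exact sin_pos_of_pos_of_lt_pi (by linarith [this.1]) (by linarith [this.2])
  have hsθ : ∀ x, 0 < sin (2 * clampR ε (π / 4) x) := fun x => by
    have := clampR_mem hε4.le x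
    exact sin_pos_of_pos_of_lt_pi (by linarith [this.1]) (by linarith [this.2])
  have ccr : ContinuousOn (fun s => clampR r₀ (π / 2) (r s)) (Icc 0 T) :=
    (clampR_lip _ _).continuous.comp_continuousOn cr
  have ccθ : ContinuousOn (fun s => clampR ε (π / 4) (θ s)) (Icc 0 T) :=
    (clampR_lip _ _).continuous.comp_continuousOn cθ
  have ccα : ContinuousOn (fun s => clampR (-(π / 2)) 0 (α s)) (Icc 0 T) :=
    (clampR_lip _ _).continuous.comp_continuousOn cα
  have n1 : ∀ s ∈ Icc 0 T, sin (clampR r₀ (π / 2) (r s)) ≠ 0 := fun s _ => (hsr _).ne'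
  have n2 : ∀ s ∈ Icc 0 T, sin (2 * clampR ε (π / 4) (θ s)) ≠ 0 := fun s _ => (hsθ _).ne'
  have cg : ContinuousOn g (Icc 0 T) := by
    rw [hg]; unfold alphaRHS
    fun_prop (disch := assumption)
  have c1 : ContinuousOn (fun s => cos (clampR (-(π / 2)) 0 (α s))) (Icc 0 T) := by fun_prop
  have c2 : ContinuousOn (fun s => sin (clampR (-(π / 2)) 0 (α s)) /
      sin (clampR r₀ (π / 2) (r s))) (Icc 0 T) := by
    fun_prop (disch := assumption)
  -- good times
  have range : ∀ τ, 0 < τ → τ ≤ T →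
      (∀ s ∈ Ico 0 τ, r s < π / 2 ∧ α s < 0 ∧ 0 < g s ∧ ε < θ s) →
      ∀ s ∈ Ioc 0 τ, r s ∈ Ioc r₀ (π / 2) ∧ θ s ∈ Ico ε (π / 4) ∧ α s ∈ Ioc (-(π / 2)) 0 ∧
        0 ≤ g s := by
    intro τ hτ hτT hgood s hs
    have hsub : Icc 0 s ⊆ Icc 0 T := Icc_subset_Icc le_rfl (hs.2.trans hτT)
    have hgs : ∀ u ∈ Ico 0 s, r u < π / 2 ∧ α u < 0 ∧ 0 < g u ∧ ε < θ u := fun u hu =>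
      hgood u ⟨hu.1, hu.2.trans_le hs.2⟩
    have hαl : ∀ u ∈ Ioc 0 s, -(π / 2) < α u := by
      intro u hu
      have hsu : Icc 0 u ⊆ Icc 0 T := (Icc_subset_Icc le_rfl hu.2).trans hsub
      have := mvt_gt (C := 0) hu.1 (fun v hv => ((hsolv v (hsu hv)).2.2).mono hsu)
        (fun v hv => (hgs v ⟨hv.1.le, hv.2.trans_le hu.2⟩).2.2.1)
      linarith
    have hαc : ∀ u ∈ Ioo 0 s, clampR (-(π / 2)) 0 (α u) = α u := fun u hu =>
      clampR_eq ⟨(hαl u ⟨hu.1, hu.2.le⟩).le, (hgs u ⟨hu.1.le, hu.2⟩).2.1.le⟩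
    have hrl : r₀ < r s := by
      have := mvt_gt (C := 0) hs.1 (fun v hv => ((hsolv v (hsub hv)).1).mono hsub)
        (fun v hv => by
          rw [hαc v hv]
          exact cos_pos_of_mem_Ioo ⟨by linarith [hαl v ⟨hv.1, hv.2.le⟩],
            by linarith [(hgs v ⟨hv.1.le, hv.2⟩).2.1]⟩)
      linarith
    have hθl : θ s < π / 4 := by
      have := mvt_gt (f := fun u => - θ u) (C := 0) hs.1
        (fun v hv => ((hsolv v (hsub hv)).2.1.mono hsub).neg)
        (fun v hv => by
          rw [hαc v hv, ← neg_div]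
          refine div_pos ?_ (hsr _)
          have := sin_neg_of_neg_of_neg_pi_lt (hgs v ⟨hv.1.le, hv.2⟩).2.1
            (by linarith [hαl v ⟨hv.1, hv.2.le⟩])
          linarith)
      simp only [hθi] at this
      linarith
    exact ⟨⟨hrl, end_le hs.1 (cr.mono hsub) fun u hu => (hgs u hu).1.le⟩,
      ⟨end_ge hs.1 (cθ.mono hsub) fun u hu => (hgs u hu).2.2.2.le, hθl⟩,
      ⟨hαl s ⟨hs.1, le_rfl⟩, end_le hs.1 (cα.mono hsub) fun u hu => (hgs u hu).2.1.le⟩,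
      end_ge hs.1 (cg.mono hsub) fun u hu => (hgs u hu).2.2.1.le⟩
  have hαc0 : clampR (-(π / 2)) 0 (α 0) = -(π / 2) := by
    rw [hαi]; exact clampR_eq ⟨le_rfl, by linarith⟩
  have hrc0 : clampR r₀ (π / 2) (r 0) = r₀ := by
    rw [hri]; exact clampR_eq ⟨le_rfl, by linarith⟩
  have hθc0 : clampR ε (π / 4) (θ 0) = π / 4 := by
    rw [hθi]; exact clampR_eq ⟨by linarith, le_rfl⟩
  have hg0 : 0 < g 0 := by
    simp only [hg]
    rw [hαc0, hrc0, hθc0]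
    unfold alphaRHS
    rw [cos_neg, cos_pi_div_two, sin_neg, sin_pi_div_two]
    simpa using hcot
  have hclosed : ∀ τ, 0 < τ → τ ≤ T →
      (∀ s ∈ Ico 0 τ, r s < π / 2 ∧ α s < 0 ∧ 0 < g s ∧ ε < θ s) →
      ∀ s ∈ Icc 0 τ, r s ∈ Icc r₀ (π / 2) ∧ θ s ∈ Icc ε (π / 4) ∧ α s ∈ Icc (-(π / 2)) 0 ∧
        0 ≤ g s := by
    intro τ hτ hτT hgood s hs
    rcases hs.1.eq_or_lt with h | h
    · rw [← h, hri, hθi, hαi]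
      exact ⟨⟨le_rfl, hr2.le⟩, ⟨hε4.le, le_rfl⟩, ⟨le_rfl, by linarith⟩, hg0.le⟩
    · obtain ⟨h1, h2, h3, h4⟩ := range τ hτ hτT hgood s ⟨h, hs.2⟩
      exact ⟨Ioc_subset_Icc_self h1, Ico_subset_Icc_self h2, Ioc_subset_Icc_self h3, h4⟩
  have hgeq : ∀ τ, 0 < τ → τ ≤ T →
      (∀ s ∈ Ico 0 τ, r s < π / 2 ∧ α s < 0 ∧ 0 < g s ∧ ε < θ s) →
      ∀ s ∈ Icc 0 τ, clampR r₀ (π / 2) (r s) = r s ∧ clampR (-(π / 2)) 0 (α s) = α s ∧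
        g s = alphaRHS n H (r s) (θ s) (α s) := by
    intro τ hτ hτT hgood s hs
    obtain ⟨h1, h2, h3, h4⟩ := hclosed τ hτ hτT hgood s hs
    refine ⟨clampR_eq h1, clampR_eq h3, ?_⟩
    simp only [hg]
    rw [clampR_eq h1, clampR_eq h2, clampR_eq h3]
  have hder : ∀ τ, 0 < τ → τ ≤ T →
      (∀ s ∈ Ico 0 τ, r s < π / 2 ∧ α s < 0 ∧ 0 < g s ∧ ε < θ s) →
      ∀ s ∈ Icc 0 τ, HasDerivWithinAt r (cos (α s)) (Icc 0 τ) s ∧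
        HasDerivWithinAt θ (sin (α s) / sin (r s)) (Icc 0 τ) s ∧
        HasDerivWithinAt α (alphaRHS n H (r s) (θ s) (α s)) (Icc 0 τ) s := by
    intro τ hτ hτT hgood s hs
    obtain ⟨h1, h2, h3⟩ := hgeq τ hτ hτT hgood s hs
    have hsub : Icc 0 τ ⊆ Icc 0 T := Icc_subset_Icc le_rfl hτT
    obtain ⟨d1, d2, d3⟩ := hsolv s (hsub hs)
    rw [h2] at d1
    rw [h1, h2] at d2
    change HasDerivWithinAt α (g s) _ _ at d3
    rw [h3] at d3
    exact ⟨d1.mono hsub, d2.mono hsub, d3.mono hsub⟩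
  have hfin : ∀ τ, 0 < τ → τ ≤ T →
      (∀ s ∈ Ico 0 τ, r s < π / 2 ∧ α s < 0 ∧ 0 < g s ∧ ε < θ s) → τ < T ∧ ε < θ τ := by
    intro τ hτ hτT hgood
    have hd := hder τ hτ hτT hgood
    refine hap τ r θ α hτ (fun s hs => (hd s hs).1) (fun s hs => (hd s hs).2.1)
      (fun s hs => (hd s hs).2.2) hri hθi hαi ?_
    intro s hs
    obtain ⟨h1, h2, h3, h4⟩ := hclosed τ hτ hτT hgood s hs
    rw [(hgeq τ hτ hτT hgood s hs).2.2] at h4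
    exact ⟨h1, hε.trans_le h2.1, h2.2, h3, h4⟩
  -- the bad set
  set m : ℝ → ℝ := fun s => min (min (π / 2 - r s) (- α s)) (min (g s) (θ s - ε)) with hm
  have hmpos : ∀ s, 0 < m s ↔ (r s < π / 2 ∧ α s < 0 ∧ 0 < g s ∧ ε < θ s) := by
    intro s
    simp only [hm, lt_min_iff, sub_pos, neg_pos]
    tauto
  have cm : ContinuousOn m (Icc 0 T) := by fun_prop
  set S : Set ℝ := Icc 0 T ∩ m ⁻¹' Iic 0 with hS
  have hScl : IsClosed S := cm.preimage_isClosed_of_isClosed isClosed_Icc isClosed_Iic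
  have hSne : S.Nonempty := by
    by_contra hne
    rw [Set.not_nonempty_iff_eq_empty] at hne
    have := hfin T hT le_rfl (fun s hs => by
      rw [← hmpos]
      by_contra hcon
      have : s ∈ S := ⟨⟨hs.1, hs.2.le⟩, not_lt.1 hcon⟩
      rw [hne] at this
      exact this)
    exact lt_irrefl _ this.1
  have hSb : BddBelow S := ⟨0, fun s hs => hs.1.1⟩
  have hmem := hScl.csInf_mem hSne hSb
  set t := sInf S with ht
  have htT : t ≤ T := hmem.1.2
  have hm0 : 0 < m 0 := by
    rw [hmpos, hri, hθi, hαi]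
    exact ⟨hr2, by linarith, hg0, hε4⟩
  have ht0 : 0 < t := by
    rcases hmem.1.1.eq_or_lt with h | h
    · have := hmem.2
      rw [← h] at this
      exact absurd hm0 (not_lt.2 this)
    · exact h
  have hgood : ∀ s ∈ Ico 0 t, r s < π / 2 ∧ α s < 0 ∧ 0 < g s ∧ ε < θ s := by
    intro s hs
    rw [← hmpos]
    by_contra hcon
    have : s ∈ S := ⟨⟨hs.1, hs.2.le.trans htT⟩, not_lt.1 hcon⟩
    exact absurd (csInf_le hSb this) (not_le.2 hs.2)
  have hd := hder t ht0 htT hgood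
  have hq := hgeq t ht0 htT hgood
  have hsub : Icc 0 t ⊆ Icc 0 T := Icc_subset_Icc le_rfl htT
  have hθt := (hfin t ht0 htT hgood).2
  have hmt : ¬ (r t < π / 2 ∧ α t < 0 ∧ 0 < g t ∧ ε < θ t) := by
    rw [← hmpos]; exact not_lt.2 hmem.2
  have hdα : ∀ s ∈ Icc 0 t, derivWithin α (Icc 0 t) s = g s := by
    intro s hs
    rw [(hq s hs).2.2]
    exact (hd s hs).2.2.derivWithin (uniqueDiffOn_Icc ht0 s hs)
  have hrt := range t ht0 htT hgood
  refine ⟨t, r, θ, α, ?_⟩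
  refine
    { hsStar := ht0
      hr₀ := hr₀
      hC1r := c1_aux ht0 (fun s hs => (hsolv s (hsub hs)).1.mono hsub) (c1.mono hsub)
      hC1θ := c1_aux ht0 (fun s hs => (hsolv s (hsub hs)).2.1.mono hsub) (c2.mono hsub)
      hC1α := c1_aux ht0 (fun s hs => (hsolv s (hsub hs)).2.2.mono hsub) (cg.mono hsub)
      hsol := ?_
      hr0 := hri
      hθ0 := hθi
      hα0 := hαi
      hval := ?_
      hαdot := ?_
      hθend := hε.trans hθt
      hend := ?_ }
  · intro s hs
    have hs' := Ioo_subset_Icc_self hs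
    obtain ⟨h1, h2, h3⟩ := hd s hs'
    obtain ⟨k1, k2, -⟩ := hrt s ⟨hs.1, hs.2.le⟩
    refine ⟨?_, ?_, h1.mono Ioo_subset_Icc_self, h2.mono Ioo_subset_Icc_self,
      h3.mono Ioo_subset_Icc_self⟩
    · exact (sin_pos_of_pos_of_lt_pi (by linarith [k1.1]) (by linarith [k1.2])).ne'
    · exact (sin_pos_of_pos_of_lt_pi (by linarith [k2.1]) (by linarith [k2.2])).ne'
  · intro s hs
    obtain ⟨k1, k2, k3, -⟩ := hrt s ⟨hs.1, hs.2.le⟩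
    obtain ⟨j1, j2, -⟩ := hgood s ⟨hs.1.le, hs.2⟩
    exact ⟨⟨by linarith [k1.1], j1⟩, ⟨by linarith [k2.1], k2.2⟩, ⟨k3.1, j2⟩⟩
  · intro s hs
    rw [hdα s (Ioo_subset_Icc_self hs)]
    exact (hgood s ⟨hs.1.le, hs.2⟩).2.2.1
  · obtain ⟨k1, k2, k3, k4⟩ := hrt t ⟨ht0, le_rfl⟩
    rw [hdα t ⟨ht0.le, le_rfl⟩]
    by_contra hcon
    push Not at hcon
    exact hmt ⟨lt_of_le_of_ne k1.2 hcon.1, lt_of_le_of_ne k3.2 hcon.2.1,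
      lt_of_le_of_ne k4 hcon.2.2.symm, hθt⟩
end

section
/- Let n ≥ 2, H < 0, and let (r, θ, α) be a monotone maximal solution on (0, s∗) of the CMC profile ODE system with initial value r₀. If 3√2·H·(1 − 1/sin r₀) < 1, H ≥ −(√2/2)·(2n−3), and √2·(n−1)·tan( (2/(2n−1))·( π/4 − H·(1 − 1/sin r₀)·(3√2·π/4) ) ) + H ≥ 0, then α̇(s∗) ≠ 0. -/
open Real Set

lemma deriv_nonpos_endpoint {F : ℝ → ℝ} {F' b : ℝ} (hb : 0 < b)
    (hF : HasDerivWithinAt F F' (Icc 0 b) b) (hpos : ∀ s ∈ Ioo 0 b, 0 < F s) (h0 : F b = 0) :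
    F' ≤ 0 := by
  have h := (hF.mono Ioo_subset_Icc_self)
  rw [hasDerivWithinAt_iff_tendsto_slope] at h
  have hs : Ioo 0 b \ {b} = Ioo 0 b := by
    ext x; simp only [mem_sdiff, mem_singleton_iff, and_iff_left_iff_imp]; intro h; exact h.2.ne
  rw [hs] at h
  have : (nhdsWithin b (Ioo 0 b)).NeBot := by
    rw [← mem_closure_iff_nhdsWithin_neBot, closure_Ioo hb.ne]
    exact ⟨hb.le, le_rfl⟩
  refine le_of_tendsto h ?_
  filter_upwards [self_mem_nhdsWithin] with s hs
  rw [slope_def_field, h0]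
  have := hpos s hs
  apply div_nonpos_of_nonneg_of_nonpos <;> linarith [hs.2]

/-- The algebraic contradiction at an endpoint with `α ≤ -π/4`. -/
lemma alg_contra {N c x y z : ℝ} (hN : 2 ≤ N) (hc : 0 < c) (hx : 0 < x) (hxy : x ≤ y)
    (hz : z ≤ 1)
    (h : y * (2 * (2 * N - 2) * (1 + c ^ 2) - (2 * N - 1)) ≤ (2 * N - 2) * c * x * z) : False := by
  have e1 : (2 * N - 2) * c * x * z ≤ (2 * N - 2) * c * x * 1 := by
    apply mul_le_mul_of_nonneg_left hz
    have : 0 < 2 * N - 2 := by linarith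
    positivity
  have e2 : (2 * N - 2) * c * x ≤ (2 * N - 2) * c * y := by
    apply mul_le_mul_of_nonneg_left hxy
    have : 0 < 2 * N - 2 := by linarith
    positivity
  have hy : 0 < y := by linarith
  have e3 : y * (2 * (2 * N - 2) * (1 + c ^ 2) - (2 * N - 1)) ≤ y * ((2 * N - 2) * c) := by linarith
  have e4 := le_of_mul_le_mul_left e3 hy
  nlinarith [sq_nonneg (4 * c - 1), mul_nonneg (sub_nonneg.2 hN) (sq_nonneg (4 * c - 1))]

set_option maxHeartbeats 4000000 in
/-- If `3√2·H·(1 − 1/sin r₀) < 1`, `H ≥ −(√2/2)·(2n−3)` and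
`√2·(n−1)·tan((2/(2n−1))·(π/4 − H·(1 − 1/sin r₀)·(3√2·π/4))) + H ≥ 0`, then
`α̇(s∗) ≠ 0`. -/
theorem alpha_deriv_endpoint_ne_zero (n : ℕ) (hn : 2 ≤ n) (H : ℝ) (hH : H < 0)
    (r θ α : ℝ → ℝ) (r₀ sStar : ℝ)
    (hsol : IsMonotoneMaximalSolution n H r θ α r₀ sStar)
    (h1 : 3 * Real.sqrt 2 * H * (1 - 1 / Real.sin r₀) < 1)
    (h2 : -(Real.sqrt 2 / 2) * (2 * (n : ℝ) - 3) ≤ H)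
    (h3 : 0 ≤ Real.sqrt 2 * ((n : ℝ) - 1) *
        Real.tan ((2 / (2 * (n : ℝ) - 1)) *
          (Real.pi / 4 - H * (1 - 1 / Real.sin r₀) * (3 * Real.sqrt 2 * Real.pi / 4))) + H) :
    derivWithin α (Icc 0 sStar) sStar ≠ 0 := by
  have hnR : (2:ℝ) ≤ n := by exact_mod_cast hn
  obtain ⟨hs, hr₀, hC1r, hC1θ, hC1α, hode, hr0, hθ0, hα0, hval, hαdot, hθend, -⟩ := hsol
  intro hzero
  have hπ := Real.pi_pos
  set N : ℝ := (n : ℝ) with hN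
  have h2N : 0 < 2 * N - 1 := by linarith
  have hr₀' : r₀ < π / 2 := by
    have h := hr₀.2
    unfold arccot at h
    have : 0 < arctan (-H / (2 * N - 1)) := by
      rw [Real.arctan_pos]; exact div_pos (by linarith) h2N
    linarith
  have hU := uniqueDiffOn_Icc hs
  have hopen : ∀ s ∈ Ioo 0 sStar, Icc 0 sStar ∈ nhds s := fun s h => Icc_mem_nhds h.1 h.2
  have hcr := hC1r.continuousOn
  have hcθ := hC1θ.continuousOn
  have hcα := hC1α.continuousOn
  -- derivatives in the interior
  have hdr : ∀ s ∈ Ioo 0 sStar, HasDerivAt r (cos (α s)) s := fun s h =>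
    (hode s h).2.2.1.hasDerivAt (Ioo_mem_nhds h.1 h.2)
  have hdθ : ∀ s ∈ Ioo 0 sStar, HasDerivAt θ (sin (α s) / sin (r s)) s := fun s h =>
    (hode s h).2.2.2.1.hasDerivAt (Ioo_mem_nhds h.1 h.2)
  have hdα : ∀ s ∈ Ioo 0 sStar, HasDerivAt α (alphaRHS n H (r s) (θ s) (α s)) s := fun s h =>
    (hode s h).2.2.2.2.hasDerivAt (Ioo_mem_nhds h.1 h.2)
  have hpos : ∀ s ∈ Ioo 0 sStar, 0 < alphaRHS n H (r s) (θ s) (α s) := by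
    intro s h
    have := hαdot s h
    rwa [(hdα s h).hasDerivWithinAt.derivWithin (hU s (Ioo_subset_Icc_self h))] at this
  -- monotonicity
  have hmr : StrictMonoOn r (Icc 0 sStar) := by
    apply strictMonoOn_of_deriv_pos (convex_Icc _ _) hcr
    rw [interior_Icc]; intro s h
    rw [(hdr s h).deriv]
    obtain ⟨-, -, h3⟩ := hval s h
    exact cos_pos_of_mem_Ioo ⟨h3.1, by linarith [h3.2]⟩
  have hmα : StrictMonoOn α (Icc 0 sStar) := by
    apply strictMonoOn_of_deriv_pos (convex_Icc _ _) hcα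
    rw [interior_Icc]; intro s h
    rw [(hdα s h).deriv]
    exact hpos s h
  have hmθ : StrictAntiOn θ (Icc 0 sStar) := by
    apply strictAntiOn_of_deriv_neg (convex_Icc _ _) hcθ
    rw [interior_Icc]; intro s h
    rw [(hdθ s h).deriv]
    obtain ⟨h1, -, h3⟩ := hval s h
    exact div_neg_of_neg_of_pos (sin_neg_of_neg_of_neg_pi_lt h3.2 (by linarith [h3.1]))
      (sin_pos_of_pos_of_lt_pi h1.1 (by linarith [h1.2]))
  have m0 : (0:ℝ) ∈ Icc 0 sStar := ⟨le_rfl, hs.le⟩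
  have m1 : sStar ∈ Icc 0 sStar := ⟨hs.le, le_rfl⟩
  have hcl : closure (Ioo 0 sStar) = Icc 0 sStar := closure_Ioo hs.ne
  have hrle : ∀ s ∈ Icc 0 sStar, r s ≤ π / 2 := by
    intro s h
    rw [← hcl] at h
    exact ContinuousWithinAt.closure_le h ((hcr s (hcl ▸ h)).mono Ioo_subset_Icc_self)
      continuousWithinAt_const (fun y hy => (hval y hy).1.2.le)
  have hαle : ∀ s ∈ Icc 0 sStar, α s ≤ 0 := by
    intro s h
    rw [← hcl] at h
    exact ContinuousWithinAt.closure_le h ((hcα s (hcl ▸ h)).mono Ioo_subset_Icc_self)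
      continuousWithinAt_const (fun y hy => (hval y hy).2.2.2.le)
  have hrge : ∀ s ∈ Icc 0 sStar, r₀ ≤ r s := by
    intro s h; rw [← hr0]; exact hmr.monotoneOn m0 h h.1
  have hθle : ∀ s ∈ Icc 0 sStar, θ s ≤ π / 4 := by
    intro s h; rw [← hθ0]; exact hmθ.antitoneOn m0 h h.1
  have hθge : ∀ s ∈ Icc 0 sStar, θ sStar ≤ θ s := by
    intro s h; exact hmθ.antitoneOn h m1 h.2
  have hsr : ∀ s ∈ Icc 0 sStar, 0 < sin (r s) := by
    intro s h
    exact sin_pos_of_pos_of_lt_pi (by linarith [hrge s h, hr₀.1]) (by linarith [hrle s h])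
  have hsθ : ∀ s ∈ Icc 0 sStar, 0 < sin (2 * θ s) := by
    intro s h
    exact sin_pos_of_pos_of_lt_pi (by linarith [hθge s h]) (by linarith [hθle s h])
  have hcF : ContinuousOn (fun s => alphaRHS n H (r s) (θ s) (α s)) (Icc 0 sStar) := by
    unfold alphaRHS
    have a1 : ContinuousOn (fun s => sin (r s)) (Icc 0 sStar) := continuous_sin.comp_continuousOn hcr
    have a2 : ContinuousOn (fun s => sin (2 * θ s)) (Icc 0 sStar) :=
      continuous_sin.comp_continuousOn (continuousOn_const.mul hcθ)
    have a3 : ContinuousOn (fun s => cos (2 * θ s)) (Icc 0 sStar) :=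
      continuous_cos.comp_continuousOn (continuousOn_const.mul hcθ)
    have a4 : ContinuousOn (fun s => cos (α s)) (Icc 0 sStar) := continuous_cos.comp_continuousOn hcα
    have a5 : ContinuousOn (fun s => sin (α s)) (Icc 0 sStar) := continuous_sin.comp_continuousOn hcα
    have a6 : ContinuousOn (fun s => cos (r s)) (Icc 0 sStar) := continuous_cos.comp_continuousOn hcr
    have b1 : ∀ s ∈ Icc 0 sStar, sin (r s) ≠ 0 := fun s h => (hsr s h).ne'
    have b2 : ∀ s ∈ Icc 0 sStar, sin (2 * θ s) ≠ 0 := fun s h => (hsθ s h).ne'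
    exact ((((continuousOn_const.mul (a3.div a2 b2)).mul a4).div a1 b1).sub
      ((continuousOn_const.mul (a6.div a1 b1)).mul a5)).add continuousOn_const
  -- the ODE at the right endpoint
  have key : ∀ f g : ℝ → ℝ, ContDiffOn ℝ 1 f (Icc 0 sStar) → ContinuousOn g (Icc 0 sStar) →
      (∀ s ∈ Ioo 0 sStar, HasDerivAt f (g s) s) →
      HasDerivWithinAt f (g sStar) (Icc 0 sStar) sStar := by
    intro f g hf hg hfg
    have hE : EqOn (derivWithin f (Icc 0 sStar)) g (Icc 0 sStar) := by
      refine EqOn.of_subset_closure (s := Ioo 0 sStar) ?_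
        (hf.continuousOn_derivWithin hU le_rfl) hg Ioo_subset_Icc_self hcl.ge
      intro s h
      exact (hfg s h).hasDerivWithinAt.derivWithin (hU s (Ioo_subset_Icc_self h))
    rw [← hE m1]
    exact ((hf.differentiableOn one_ne_zero) sStar m1).hasDerivWithinAt
  have er := key r (fun s => cos (α s)) hC1r (continuous_cos.comp_continuousOn hcα) hdr
  have eθ := key θ (fun s => sin (α s) / sin (r s)) hC1θ
    ((continuous_sin.comp_continuousOn hcα).div (continuous_sin.comp_continuousOn hcr)
      (fun s h => (hsr s h).ne')) hdθ
  have eα := key α (fun s => alphaRHS n H (r s) (θ s) (α s)) hC1α hcF hdα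
  have hF0 : alphaRHS n H (r sStar) (θ sStar) (α sStar) = 0 := by
    rw [← hzero]; exact (eα.derivWithin (hU _ m1)).symm
  simp only [hF0] at eα er eθ
  have hS := hsr _ m1
  have hT := hsθ _ m1
  have hθlt : θ sStar < π / 4 := by rw [← hθ0]; exact hmθ m0 m1 hs
  have hCT : 0 < cos (2 * θ sStar) := cos_pos_of_mem_Ioo ⟨by linarith, by linarith⟩
  have hαgt : -(π / 2) < α sStar := by rw [← hα0]; exact hmα m0 m1 hs
  have hCα : 0 < cos (α sStar) := cos_pos_of_mem_Ioo ⟨hαgt, by linarith [hαle _ m1]⟩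
  have hCr : 0 ≤ cos (r sStar) := cos_nonneg_of_mem_Icc
    ⟨by linarith [hrge _ m1, hr₀.1], hrle _ m1⟩
  have hSα : sin (α sStar) ≤ 0 := sin_nonpos_of_nonpos_of_neg_pi_le (hαle _ m1) (by linarith)
  -- second derivative at the endpoint
  have hα4 : -(π / 4) < α sStar := by
    by_contra hcon
    push Not at hcon
    have d1 := ((eθ.const_mul 2).cos.div (eθ.const_mul 2).sin hT.ne').const_mul (2 * N - 2)
    have d2 := (d1.mul eα.cos).div er.sin hS.ne'
    have d3 := ((er.cos.div er.sin hS.ne').const_mul (2 * N - 1)).mul eα.sin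
    have d4 := (d2.sub d3).add_const H
    have hle := deriv_nonpos_endpoint hs d4 (fun s h => hpos s h) hF0
    simp only [Pi.div_apply, Pi.mul_apply] at hle
    have hxy : cos (α sStar) ≤ -sin (α sStar) := by
      rw [← sin_neg, ← cos_pi_div_two_sub]
      rw [← cos_neg (α sStar)]
      exact cos_le_cos_of_nonneg_of_le_pi (by linarith) (by linarith) (by linarith)
    refine alg_contra (c := cos (2 * θ sStar) / sin (2 * θ sStar)) hnR (div_pos hCT hT) hCα hxy
      (cos_le_one (r sStar)) ?_
    have t1 := sin_sq_add_cos_sq (2 * θ sStar)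
    have t2 := sin_sq_add_cos_sq (r sStar)
    generalize sin (2 * θ sStar) = a at *
    generalize cos (2 * θ sStar) = b at *
    generalize sin (r sStar) = u at *
    generalize cos (r sStar) = v at *
    generalize cos (α sStar) = x at *
    generalize sin (α sStar) = y at *
    rw [← sub_nonneg]
    rw [← neg_nonneg] at hle
    have hmul := mul_nonneg (div_nonneg (sq_nonneg u) hCα.le) hle
    refine hmul.trans_eq ?_
    have hb : b ^ 2 = 1 - a ^ 2 := by linarith
    have hv : v ^ 2 = 1 - u ^ 2 := by linarith
    field_simp
    linear_combination (-(x * a ^ 2 * (2 * N - 1) * y)) * t2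
  -- time at which α = -π/4
  obtain ⟨s1, hs1, hαs1⟩ : ∃ s ∈ Icc 0 sStar, α s = -(π / 4) :=
    intermediate_value_Icc hs.le hcα ⟨by rw [hα0]; linarith, hα4.le⟩
  have hs1lt : s1 < sStar := by
    rcases hs1.2.lt_or_eq with h | h
    · exact h
    · rw [h] at hαs1; linarith
  have hs1pos : 0 < s1 := by
    rcases hs1.1.lt_or_eq with h | h
    · exact h
    · rw [← h] at hαs1; linarith
  have hsub : Icc 0 s1 ⊆ Icc 0 sStar := Icc_subset_Icc_right hs1.2
  have hsubo : Ioo 0 s1 ⊆ Ioo 0 sStar := Ioo_subset_Ioo_right hs1.2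
  have hs2 : 0 < √2 := by positivity
  have hs2sq : √2 * √2 = 2 := mul_self_sqrt (by norm_num)
  have hαs : ∀ s ∈ Ioo 0 s1, cos (α s) ≤ √2 / 2 ∧ sin (α s) ≤ -(√2 / 2) := by
    intro s h
    have h4 : α s ≤ -(π / 4) := by
      rw [← hαs1]; exact hmα.monotoneOn (hsub (Ioo_subset_Icc_self h)) hs1 h.2.le
    have h5 := (hval s (hsubo h)).2.2
    constructor
    · rw [← cos_pi_div_four, ← cos_neg (α s)]
      exact cos_le_cos_of_nonneg_of_le_pi (by linarith) (by linarith [h5.1]) (by linarith)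
    · rw [← sin_pi_div_four, ← sin_neg]
      exact sin_le_sin_of_le_of_le_pi_div_two (by linarith [h5.1]) (by linarith) h4
  -- bound on s1
  have hs1b : √2 / 2 * s1 < π / 4 := by
    have hA : AntitoneOn (fun s => θ s + √2 / 2 * s) (Icc 0 s1) := by
      apply antitoneOn_of_deriv_nonpos (convex_Icc _ _)
      · exact (hcθ.mono hsub).add (continuousOn_const.mul continuousOn_id)
      · rw [interior_Icc]; intro s h
        exact ((hdθ s (hsubo h)).add
          ((hasDerivAt_id s).const_mul (√2 / 2))).differentiableAt.differentiableWithinAt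
      · rw [interior_Icc]; intro s h
        have hd := (hdθ s (hsubo h)).add ((hasDerivAt_id s).const_mul (√2 / 2))
        refine (hd.deriv).trans_le ?_
        have hp := hsr s (hsub (Ioo_subset_Icc_self h))
        have : sin (α s) / sin (r s) ≤ -(√2 / 2) := by
          rw [div_le_iff₀ hp]
          nlinarith [(hαs s h).2, sin_le_one (r s)]
        linarith
    have := hA ⟨le_rfl, hs1pos.le⟩ ⟨hs1pos.le, le_rfl⟩ hs1pos.le
    simp only [hθ0, mul_zero, add_zero] at this
    linarith [hθge s1 hs1]
  have hq : 0 < cos (2 * θ sStar) / sin (2 * θ sStar) := div_pos hCT hT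
  have hcosα : √2 / 2 ≤ cos (α sStar) := by
    rw [← cos_pi_div_four, ← cos_neg (α sStar)]
    exact cos_le_cos_of_nonneg_of_le_pi (by linarith [hαle _ m1]) (by linarith) (by linarith)
  -- bound on cot(2θ) at the endpoint
  have hend1 : (2 * N - 2) * (cos (2 * θ sStar) / sin (2 * θ sStar)) * cos (α sStar)
      ≤ -H * sin (r sStar) := by
    have h := hF0
    unfold alphaRHS at h
    rw [← div_le_iff₀ hS]
    have : (2 * N - 1) * (cos (r sStar) / sin (r sStar)) * sin (α sStar) ≤ 0 :=
      mul_nonpos_of_nonneg_of_nonpos (mul_nonneg h2N.le (div_nonneg hCr hS.le)) hSα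
    linarith
  have hend2 : (N - 1) * √2 * (cos (2 * θ sStar) / sin (2 * θ sStar)) ≤ -H := by
    have a1 : (2 * N - 2) * (cos (2 * θ sStar) / sin (2 * θ sStar)) * (√2 / 2) ≤
        (2 * N - 2) * (cos (2 * θ sStar) / sin (2 * θ sStar)) * cos (α sStar) := by
      apply mul_le_mul_of_nonneg_left hcosα
      exact mul_nonneg (by linarith) hq.le
    have a2 : -H * sin (r sStar) ≤ -H * 1 :=
      mul_le_mul_of_nonneg_left (sin_le_one _) (by linarith)
    linarith
  have hsr0 : 0 < sin r₀ := by rw [← hr0]; exact hsr 0 m0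
  have hsr0lt : sin r₀ < 1 := by
    rw [← sin_pi_div_two]
    exact sin_lt_sin_of_lt_of_le_pi_div_two (by linarith [hr₀.1]) le_rfl hr₀'
  obtain ⟨K, hK⟩ : ∃ K, K = H * (1 - 1 / sin r₀) := ⟨_, rfl⟩
  have hKpos : 0 < K := by
    rw [hK]; apply mul_pos_of_neg_of_neg hH
    have := one_lt_one_div hsr0 hsr0lt
    linarith
  -- comparison
  have hcomp : π / 4 ≤ (2 * N - 1) * (π / 4 - θ s1) + K * s1 := by
    have hA : AntitoneOn (fun s => α s + (2 * N - 1) * θ s + (-K) * s) (Icc 0 s1) := by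
      have hd : ∀ s ∈ Ioo 0 s1, HasDerivAt (fun s => α s + (2 * N - 1) * θ s + (-K) * s)
          (alphaRHS n H (r s) (θ s) (α s) + (2 * N - 1) * (sin (α s) / sin (r s)) + (-K) * 1) s :=
        fun s h => ((hdα s (hsubo h)).add ((hdθ s (hsubo h)).const_mul (2 * N - 1))).add
          ((hasDerivAt_id s).const_mul (-K))
      apply antitoneOn_of_deriv_nonpos (convex_Icc _ _)
      · exact ((hcα.mono hsub).add (continuousOn_const.mul (hcθ.mono hsub))).add
          (continuousOn_const.mul continuousOn_id)
      · rw [interior_Icc]; intro s h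
        exact (hd s h).differentiableAt.differentiableWithinAt
      · rw [interior_Icc]; intro s h
        rw [(hd s h).deriv]
        have hm := hsub (Ioo_subset_Icc_self h)
        have hp := hsr s hm
        have hcot : cos (2 * θ s) / sin (2 * θ s) ≤ cos (2 * θ sStar) / sin (2 * θ sStar) := by
          apply div_le_div₀ hCT.le _ hT _
          · exact cos_le_cos_of_nonneg_of_le_pi (by linarith) (by linarith [hθle s hm])
              (by linarith [hθge s hm])
          · exact sin_le_sin_of_le_of_le_pi_div_two (by linarith) (by linarith [hθle s hm])
              (by linarith [hθge s hm])
        have hcs : 0 ≤ cos (2 * θ s) / sin (2 * θ s) := div_nonneg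
          (cos_nonneg_of_mem_Icc ⟨by linarith [hθge s hm], by linarith [hθle s hm]⟩) (hsθ s hm).le
        have b1 : (2 * N - 2) * (cos (2 * θ s) / sin (2 * θ s)) * cos (α s) ≤ -H := by
          have c1 : (2 * N - 2) * (cos (2 * θ s) / sin (2 * θ s)) * cos (α s) ≤
              (2 * N - 2) * (cos (2 * θ s) / sin (2 * θ s)) * (√2 / 2) :=
            mul_le_mul_of_nonneg_left (hαs s h).1 (mul_nonneg (by linarith) hcs)
          have c2 : (N - 1) * √2 * (cos (2 * θ s) / sin (2 * θ s)) ≤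
              (N - 1) * √2 * (cos (2 * θ sStar) / sin (2 * θ sStar)) :=
            mul_le_mul_of_nonneg_left hcot (mul_nonneg (by linarith) hs2.le)
          linarith
        have b2 : (2 * N - 2) * (cos (2 * θ s) / sin (2 * θ s)) * cos (α s) / sin (r s)
            ≤ -H * (1 / sin r₀) := by
          have c1 : (2 * N - 2) * (cos (2 * θ s) / sin (2 * θ s)) * cos (α s) / sin (r s)
              ≤ -H / sin (r s) := div_le_div_of_nonneg_right b1 hp.le
          have c2 : 1 / sin (r s) ≤ 1 / sin r₀ := by
            apply one_div_le_one_div_of_le hsr0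
            exact sin_le_sin_of_le_of_le_pi_div_two (by linarith [hr₀.1]) (hrle s hm) (hrge s hm)
          have c3 := mul_le_mul_of_nonneg_left c2 (show 0 ≤ -H by linarith)
          rw [mul_one_div] at c3
          linarith
        have b3 : (2 * N - 1) * (sin (α s) / sin (r s)) ≤
            (2 * N - 1) * (cos (r s) / sin (r s)) * sin (α s) := by
          have e : (2 * N - 1) * (cos (r s) / sin (r s)) * sin (α s) =
            (2 * N - 1) * (cos (r s) * sin (α s) / sin (r s)) := by ring
          rw [e]
          apply mul_le_mul_of_nonneg_left _ h2N.le
          apply div_le_div_of_nonneg_right _ hp.le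
          have c0 : sin (α s) ≤ 0 := by linarith [(hαs s h).2]
          have c1 := mul_nonneg (sub_nonneg.2 (cos_le_one (r s))) (neg_nonneg.2 c0)
          linarith
        unfold alphaRHS
        rw [hK]
        linarith
    have := hA ⟨le_rfl, hs1pos.le⟩ ⟨hs1pos.le, le_rfl⟩ hs1pos.le
    simp only [hθ0, hα0, hαs1] at this
    linarith
  -- conclusion
  have hs1c : K * s1 < K * (3 * √2 * π / 4) := by
    apply mul_lt_mul_of_pos_left _ hKpos
    have : √2 * (√2 / 2 * s1) < √2 * (π / 4) := mul_lt_mul_of_pos_left hs1b hs2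
    have e : √2 * (√2 / 2 * s1) = s1 := by linear_combination (s1 / 2) * hs2sq
    nlinarith [mul_pos hs2 hπ]
  have hX : (2 / (2 * N - 1)) * (π / 4 - K * (3 * √2 * π / 4)) < π / 2 - 2 * θ sStar := by
    rw [div_mul_eq_mul_div, div_lt_iff₀ h2N]
    have := mul_le_mul_of_nonneg_left (hθge s1 hs1) h2N.le
    linarith
  have hX0 : 0 ≤ (2 / (2 * N - 1)) * (π / 4 - K * (3 * √2 * π / 4)) := by
    apply mul_nonneg (by positivity)
    have : 3 * √2 * K < 1 := by rw [hK]; linarith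
    nlinarith
  have htan := tan_lt_tan_of_nonneg_of_lt_pi_div_two hX0 (by linarith) hX
  rw [tan_pi_div_two_sub, tan_eq_sin_div_cos (2 * θ sStar), inv_div] at htan
  rw [← hK] at h3
  have := mul_lt_mul_of_pos_left htan (mul_pos hs2 (show 0 < N - 1 by linarith))
  linarith
end

section
/- Let n ≥ 2 and H < 0, and write a(H) = arccot((−H)/(2n−1)). For every ε' > 0 there exists η > 0 such that: whenever r₀ ∈ (0, a(H)) with a(H) − r₀ < η and (r, θ, α) is a monotone maximal solution on (0, s∗) of the CMC profile ODE system with initial value r₀, one has |r(s∗) − a(H)| < ε'. In other words, r(s∗) → a(H) as r₀ → a(H). -/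
open Real Set

/-- Mean value inequality, upper bound. -/
lemma mvt_upper {f f' : ℝ → ℝ} {x y K : ℝ} (hxy : x ≤ y) (hc : ContinuousOn f (Icc x y))
    (hd : ∀ s ∈ Ioo x y, HasDerivAt f (f' s) s) (hK : ∀ s ∈ Ioo x y, f' s ≤ K) :
    f y - f x ≤ K * (y - x) := by
  refine (convex_Icc x y).image_sub_le_mul_sub_of_deriv_le hc ?_ ?_ x (left_mem_Icc.2 hxy) y
    (right_mem_Icc.2 hxy) hxy
  · rw [interior_Icc]
    exact fun s hs => (hd s hs).differentiableAt.differentiableWithinAt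
  · rw [interior_Icc]
    intro s hs
    rw [(hd s hs).deriv]
    exact hK s hs

/-- Mean value inequality, lower bound. -/
lemma mvt_lower {f f' : ℝ → ℝ} {x y K : ℝ} (hxy : x ≤ y) (hc : ContinuousOn f (Icc x y))
    (hd : ∀ s ∈ Ioo x y, HasDerivAt f (f' s) s) (hK : ∀ s ∈ Ioo x y, K ≤ f' s) :
    K * (y - x) ≤ f y - f x := by
  have := mvt_upper (f := fun s => - f s) (f' := fun s => - f' s) (K := -K) hxy hc.neg
    (fun s hs => (hd s hs).neg) (fun s hs => neg_le_neg (hK s hs))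
  linarith

set_option maxHeartbeats 2000000 in
/-- The quantitative estimate for a single solution. -/
lemma endpoint_bound (n : ℕ) (hn : 2 ≤ n) (H : ℝ) (hH : H < 0) {r θ α : ℝ → ℝ} {r₀ S : ℝ}
    (h : IsMonotoneMaximalSolution n H r θ α r₀ S) {M c σ δ C : ℝ} (hM : 0 < M)
    (hc : c = 1 / (M - H)) (hσ : 0 < σ) (hσr : σ ≤ Real.sin r₀)
    (hδ : 0 < δ) (hδr : (2 * (n : ℝ) - 1) * (Real.cos r₀ / Real.sin r₀) ≤ -H + δ)
    (hC : C = (2 * (n : ℝ) - 2) * (1 / c) / σ)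
    (hsmall : 2 * δ * Real.exp (2 * C) < Real.pi / 4) :
    r₀ ≤ r S ∧ r S ≤ r₀ + 4 * δ * Real.exp (2 * C) + c + 1 / M := by
  have hn' : (2 : ℝ) ≤ n := by exact_mod_cast hn
  have hS := h.hsStar
  have hpi := Real.pi_pos
  have hpi4 := Real.pi_le_four
  have hcpos : 0 < c := by rw [hc]; apply one_div_pos.2; linarith
  have hcinv : 1 / c = M - H := by rw [hc]; simp
  have hCpos : 0 ≤ C := by
    rw [hC, hcinv]; apply div_nonneg (mul_nonneg _ _) hσ.le <;> linarith
  have cr := h.hC1r.continuousOn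
  have ct := h.hC1θ.continuousOn
  have ca := h.hC1α.continuousOn
  have dr : ∀ s ∈ Ioo 0 S, HasDerivAt r (Real.cos (α s)) s := fun s hs =>
    (h.hsol s hs).2.2.1.hasDerivAt (Ioo_mem_nhds hs.1 hs.2)
  have dt : ∀ s ∈ Ioo 0 S, HasDerivAt θ (Real.sin (α s) / Real.sin (r s)) s := fun s hs =>
    (h.hsol s hs).2.2.2.1.hasDerivAt (Ioo_mem_nhds hs.1 hs.2)
  have da : ∀ s ∈ Ioo 0 S, HasDerivAt α (alphaRHS n H (r s) (θ s) (α s)) s := fun s hs =>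
    (h.hsol s hs).2.2.2.2.hasDerivAt (Ioo_mem_nhds hs.1 hs.2)
  have dapos : ∀ s ∈ Ioo 0 S, 0 ≤ alphaRHS n H (r s) (θ s) (α s) := fun s hs => by
    have := h.hαdot s hs
    rw [derivWithin_of_mem_nhds (Icc_mem_nhds hs.1 hs.2), (da s hs).deriv] at this
    exact this.le
  have sub : ∀ {x y : ℝ}, 0 ≤ x → y ≤ S → Icc x y ⊆ Icc 0 S := fun hx hy =>
    Icc_subset_Icc hx hy
  have subo : ∀ {x y : ℝ}, 0 ≤ x → y ≤ S → Ioo x y ⊆ Ioo 0 S := fun hx hy =>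
    Ioo_subset_Ioo hx hy
  have cosnn : ∀ s ∈ Ioo 0 S, 0 ≤ Real.cos (α s) := fun s hs => by
    obtain ⟨-, -, ha⟩ := h.hval s hs
    exact Real.cos_nonneg_of_mem_Icc ⟨by linarith [ha.1], by linarith [ha.2]⟩
  have sinr : ∀ s ∈ Ioo 0 S, 0 < Real.sin (r s) := fun s hs => by
    obtain ⟨hr, -, -⟩ := h.hval s hs
    exact Real.sin_pos_of_pos_of_lt_pi hr.1 (by linarith [hr.2])
  have sinal : ∀ s ∈ Ioo 0 S, Real.sin (α s) ≤ 0 := fun s hs => by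
    obtain ⟨-, -, ha⟩ := h.hval s hs
    exact Real.sin_nonpos_of_nonpos_of_neg_pi_le ha.2.le (by linarith [ha.1])
  -- monotonicity
  have rmono : ∀ {x y : ℝ}, 0 ≤ x → x ≤ y → y ≤ S → r x ≤ r y := fun {x y} hx hxy hy => by
    have := mvt_lower (K := 0) hxy (cr.mono (sub hx hy)) (fun s hs => dr s (subo hx hy hs))
      (fun s hs => cosnn s (subo hx hy hs))
    linarith
  have amono : ∀ {x y : ℝ}, 0 ≤ x → x ≤ y → y ≤ S → α x ≤ α y := fun {x y} hx hxy hy => by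
    have := mvt_lower (K := 0) hxy (ca.mono (sub hx hy)) (fun s hs => da s (subo hx hy hs))
      (fun s hs => dapos s (subo hx hy hs))
    linarith
  have tanti : ∀ {x y : ℝ}, 0 ≤ x → x ≤ y → y ≤ S → θ y ≤ θ x := fun {x y} hx hxy hy => by
    have := mvt_upper (K := 0) hxy (ct.mono (sub hx hy)) (fun s hs => dt s (subo hx hy hs))
      (fun s hs => div_nonpos_of_nonpos_of_nonneg (sinal s (subo hx hy hs))
        (sinr s (subo hx hy hs)).le)
    linarith
  have rlip : ∀ {x y : ℝ}, 0 ≤ x → x ≤ y → y ≤ S → r y - r x ≤ y - x := fun {x y} hx hxy hy => by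
    have := mvt_upper (K := 1) hxy (cr.mono (sub hx hy)) (fun s hs => dr s (subo hx hy hs))
      (fun s hs => Real.cos_le_one _)
    linarith
  have half : (1 : ℝ) / 2 ≤ Real.sqrt 2 / 2 := by
    have : (1 : ℝ) ≤ Real.sqrt 2 := Real.one_le_sqrt.2 (by norm_num)
    linarith
  -- time bound while `α ≤ -π/4`
  have time1 : ∀ {x y : ℝ}, 0 ≤ x → x ≤ y → y ≤ S → α y ≤ -(Real.pi / 4) →
      y - x ≤ 2 * θ x - 2 * θ y := fun {x y} hx hxy hy hαy => by
    have := mvt_upper (K := -(1 / 2)) hxy (ct.mono (sub hx hy))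
      (fun s hs => dt s (subo hx hy hs)) (fun s hs => by
        have hs' := subo hx hy hs
        have h1 := amono hs'.1.le hs.2.le hy
        have h2 : Real.sin (α s) ≤ -(1 / 2) := by
          have := Real.sin_le_sin_of_le_of_le_pi_div_two
            (by linarith [(h.hval s hs').2.2.1]) (by linarith) (h1.trans hαy)
          rw [Real.sin_neg, Real.sin_pi_div_four] at this
          linarith
        rw [div_le_iff₀ (sinr s hs')]
        nlinarith [Real.sin_le_one (r s), sinr s hs'])
    linarith
  set θ₁ := Real.arctan c / 2 with hθ₁
  have θ₁pos : 0 < θ₁ := by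
    have := Real.arctan_pos.2 hcpos
    positivity
  have θ₁lt : θ₁ < Real.pi / 4 := by
    have := Real.arctan_lt_pi_div_two c
    linarith
  have θ₁le : 2 * θ₁ ≤ c := by
    have h1 : Real.arctan c < Real.pi / 2 := Real.arctan_lt_pi_div_two c
    have := Real.le_tan (Real.arctan_pos.2 hcpos).le h1
    rw [Real.tan_arctan] at this
    linarith
  have cotθ₁ : ∀ t ∈ Ioo 0 (Real.pi / 4), Real.cos (2 * t) / Real.sin (2 * t)
      = 1 / Real.tan (2 * t) := fun t _ => by
    rw [Real.tan_eq_sin_div_cos, one_div_div]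
  have cotle : ∀ t ∈ Ioo 0 (Real.pi / 4), θ₁ ≤ t →
      Real.cos (2 * t) / Real.sin (2 * t) ≤ M - H := fun t ht h1 => by
    rw [cotθ₁ t ht, ← hcinv]
    apply one_div_le_one_div_of_le hcpos
    have : c = Real.tan (Real.arctan c) := (Real.tan_arctan c).symm
    rw [this]
    apply (Real.strictMonoOn_tan.le_iff_le ⟨Real.neg_pi_div_two_lt_arctan c,
      Real.arctan_lt_pi_div_two c⟩ ⟨by linarith [ht.1], by linarith [ht.2]⟩).2
    linarith
  have cotge : ∀ t ∈ Ioo 0 (Real.pi / 4), t ≤ θ₁ →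
      M - H ≤ Real.cos (2 * t) / Real.sin (2 * t) := fun t ht h1 => by
    rw [cotθ₁ t ht, ← hcinv]
    apply one_div_le_one_div_of_le
    · exact Real.tan_pos_of_pos_of_lt_pi_div_two (by linarith [ht.1]) (by linarith [ht.2])
    have : c = Real.tan (Real.arctan c) := (Real.tan_arctan c).symm
    rw [this]
    apply (Real.strictMonoOn_tan.le_iff_le ⟨by linarith [ht.1], by linarith [ht.2]⟩
      ⟨Real.neg_pi_div_two_lt_arctan c, Real.arctan_lt_pi_div_two c⟩).2
    linarith
  -- stage one differential inequality
  have ineq1 : ∀ s ∈ Ioo 0 S, θ₁ ≤ θ s →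
      alphaRHS n H (r s) (θ s) (α s) ≤ C * (α s + Real.pi / 2) + δ := fun s hs h1 => by
    obtain ⟨hr, ht, ha⟩ := h.hval s hs
    have hrr : r₀ ≤ r s := by rw [← h.hr0]; exact rmono le_rfl hs.1.le hs.2.le
    have hs1 : Real.sin r₀ ≤ Real.sin (r s) :=
      Real.sin_le_sin_of_le_of_le_pi_div_two (by linarith [h.hr₀.1]) hr.2.le hrr
    have hc1 : Real.cos (r s) ≤ Real.cos r₀ :=
      Real.cos_le_cos_of_nonneg_of_le_pi h.hr₀.1.le (by linarith [hr.2]) hrr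
    have hcn : 0 ≤ Real.cos (r s) := Real.cos_nonneg_of_mem_Icc ⟨by linarith [hr.1], hr.2.le⟩
    have hsp := sinr s hs
    have hcot : Real.cos (r s) / Real.sin (r s) ≤ Real.cos r₀ / Real.sin r₀ :=
      div_le_div₀ (hcn.trans hc1) hc1 (hσ.trans_le hσr) hs1
    have hcotn : 0 ≤ Real.cos (r s) / Real.sin (r s) := div_nonneg hcn hsp.le
    have hca : Real.cos (α s) ≤ α s + Real.pi / 2 := by
      have := Real.sin_le (x := α s + Real.pi / 2) (by linarith [ha.1])
      rwa [Real.sin_add_pi_div_two] at this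
    have hca0 := cosnn s hs
    have t1 : (2 * (n : ℝ) - 2) * (Real.cos (2 * θ s) / Real.sin (2 * θ s)) * Real.cos (α s)
        / Real.sin (r s) ≤ C * (α s + Real.pi / 2) := by
      rw [hC, hcinv, div_mul_eq_mul_div]
      apply div_le_div₀
      · apply mul_nonneg (mul_nonneg _ _) <;> linarith [ha.1]
      · apply mul_le_mul _ hca hca0
        · apply mul_nonneg <;> linarith
        · exact mul_le_mul_of_nonneg_left (cotle _ ht h1) (by linarith)
      · exact hσ
      · linarith
    have t2 : (2 * (n : ℝ) - 1) * (Real.cos (r s) / Real.sin (r s)) * (- Real.sin (α s))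
        ≤ -H + δ := by
      have h3 : (2 * (n : ℝ) - 1) * (Real.cos (r s) / Real.sin (r s)) ≤ -H + δ :=
        (mul_le_mul_of_nonneg_left hcot (by linarith)).trans hδr
      have h4 : 0 ≤ (2 * (n : ℝ) - 1) * (Real.cos (r s) / Real.sin (r s)) :=
        mul_nonneg (by linarith) hcotn
      nlinarith [Real.neg_one_le_sin (α s)]
    unfold alphaRHS
    linarith
  -- stage one estimate
  have est1 : ∀ s ∈ Icc 0 S, θ₁ ≤ θ s → α s ≤ -(Real.pi / 4) →
      s ≤ 2 ∧ α s + Real.pi / 2 ≤ 2 * δ * Real.exp (2 * C) := fun s hs h1 h2 => by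
    have hs2 : s ≤ 2 := by
      have := time1 le_rfl hs.1 hs.2 h2
      rw [h.hθ0] at this
      linarith
    refine ⟨hs2, ?_⟩
    have key := mvt_upper (f := fun t => (α t + Real.pi / 2) * Real.exp (-C * t))
      (f' := fun t => alphaRHS n H (r t) (θ t) (α t) * Real.exp (-C * t)
        + (α t + Real.pi / 2) * (Real.exp (-C * t) * (-C))) (K := δ) hs.1
      (((ca.mono (sub le_rfl hs.2)).add continuousOn_const).mul (by fun_prop))
      (fun t ht => by
        have e1 : HasDerivAt (fun t => Real.exp (-C * t)) (Real.exp (-C * t) * (-C)) t := by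
          have := ((hasDerivAt_id t).const_mul (-C)).exp
          simpa using this
        exact ((da t (subo le_rfl hs.2 ht)).add_const _).mul e1)
      (fun t ht => by
        have ht' := subo le_rfl hs.2 ht
        have i1 := ineq1 t ht' (h1.trans (tanti ht.1.le ht.2.le hs.2))
        have e0 := Real.exp_pos (-C * t)
        have e1 : Real.exp (-C * t) ≤ 1 := Real.exp_le_one_iff.2 (by nlinarith [ht.1])
        have := mul_le_mul_of_nonneg_right i1 e0.le
        nlinarith)
    simp only [h.hα0] at key
    have e2 : Real.exp (-C * s) * Real.exp (C * s) = 1 := by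
      rw [← Real.exp_add]; simp
    have e3 : Real.exp (C * s) ≤ Real.exp (2 * C) := Real.exp_le_exp.2 (by nlinarith)
    have e4 := Real.exp_pos (C * s)
    have k2 : (α s + Real.pi / 2) * Real.exp (-C * s) ≤ δ * s := by linarith
    have k3 := mul_le_mul_of_nonneg_right k2 e4.le
    rw [mul_assoc, e2, mul_one] at k3
    calc _ ≤ δ * s * Real.exp (C * s) := k3
      _ ≤ (2 * δ) * Real.exp (2 * C) := by
        apply mul_le_mul _ e3 e4.le (by linarith)
        nlinarith
  have claimA : ∀ s ∈ Icc 0 S, θ₁ ≤ θ s → α s < -(Real.pi / 4) := fun s hs h1 => by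
    by_contra hcon
    push Not at hcon
    obtain ⟨t, ht, hte⟩ := intermediate_value_Icc hs.1 (ca.mono (sub le_rfl hs.2))
      (show -(Real.pi / 4) ∈ Icc (α 0) (α s) from ⟨by rw [h.hα0]; linarith, hcon⟩)
    have := (est1 t ⟨ht.1, ht.2.trans hs.2⟩ (h1.trans (tanti ht.1 ht.2 hs.2)) hte.le).2
    linarith
  have claimA2 : ∀ s ∈ Icc 0 S, θ₁ ≤ θ s → r s ≤ r₀ + 4 * δ * Real.exp (2 * C) :=
      fun s hs h1 => by
    have h2 := est1 s hs h1 (claimA s hs h1).le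
    have := mvt_upper (K := 2 * δ * Real.exp (2 * C)) hs.1 (cr.mono (sub le_rfl hs.2))
      (fun t ht => dr t (subo le_rfl hs.2 ht)) (fun t ht => by
        have ht' := subo le_rfl hs.2 ht
        have hca := Real.sin_le (x := α t + Real.pi / 2) (by linarith [(h.hval t ht').2.2.1])
        rw [Real.sin_add_pi_div_two] at hca
        have := amono ht.1.le ht.2.le hs.2
        linarith)
    rw [h.hr0] at this
    have e := Real.exp_pos (2 * C)
    have := mul_le_mul_of_nonneg_left h2.1 (show 0 ≤ 2 * δ * Real.exp (2 * C) by positivity)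
    linarith
  have αS : α S ≤ 0 := by
    have : Icc 0 S ⊆ closure (Ioo 0 S) := by rw [closure_Ioo hS.ne]
    have hcl : IsClosed (Iic (0 : ℝ)) := isClosed_Iic
    have hm : MapsTo α (closure (Ioo 0 S)) (closure (Iic 0)) := by
      apply MapsTo.closure_of_continuousOn
      · exact fun s hs => (h.hval s hs).2.2.2.le
      · rwa [closure_Ioo hS.ne]
    have := hm (this (right_mem_Icc.2 hS.le))
    rwa [hcl.closure_eq] at this
  -- stage three
  have claimC : ∀ s ∈ Icc 0 S, θ s ≤ θ₁ → -(Real.pi / 4) ≤ α s → S - s ≤ 1 / M :=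
      fun s hs h1 h2 => by
    have := mvt_lower (K := M) hs.2 (ca.mono (sub hs.1 le_rfl))
      (fun t ht => da t (subo hs.1 le_rfl ht)) (fun t ht => by
        have ht' := subo hs.1 le_rfl ht
        obtain ⟨hr, hθ, ha⟩ := h.hval t ht'
        have g1 := cotge (θ t) hθ ((tanti hs.1 ht.1.le ht.2.le).trans h1)
        have g2 : (1 : ℝ) / 2 ≤ Real.cos (α t) := by
          have : Real.cos (-(Real.pi / 4)) ≤ Real.cos (α t) := by
            rw [← Real.cos_neg (α t), Real.cos_neg]
            apply Real.cos_le_cos_of_nonneg_of_le_pi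
            · linarith [ha.2]
            · linarith
            · linarith [amono hs.1 ht.1.le ht.2.le]
          rw [Real.cos_neg, Real.cos_pi_div_four] at this
          linarith
        have hcn : 0 ≤ Real.cos (r t) :=
          Real.cos_nonneg_of_mem_Icc ⟨by linarith [hr.1], hr.2.le⟩
        have hsp := sinr t ht'
        have t2 : 0 ≤ (2 * (n : ℝ) - 1) * (Real.cos (r t) / Real.sin (r t))
            * (- Real.sin (α t)) :=
          mul_nonneg (mul_nonneg (by linarith) (div_nonneg hcn hsp.le))
            (by linarith [sinal t ht'])
        have t1 : M - H ≤ (2 * (n : ℝ) - 2) * (Real.cos (2 * θ t) / Real.sin (2 * θ t))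
            * Real.cos (α t) / Real.sin (r t) := by
          have p1 : 2 * (M - H) ≤ (2 * (n : ℝ) - 2)
              * (Real.cos (2 * θ t) / Real.sin (2 * θ t)) :=
            mul_le_mul (by linarith) g1 (by linarith) (by linarith)
          have p2 : 2 * (M - H) * (1 / 2) ≤ (2 * (n : ℝ) - 2)
              * (Real.cos (2 * θ t) / Real.sin (2 * θ t)) * Real.cos (α t) :=
            mul_le_mul p1 g2 (by norm_num) (by linarith)
          rw [le_div_iff₀ hsp]
          have p3 : (M - H) * Real.sin (r t) ≤ M - H :=
            mul_le_of_le_one_right (by linarith) (Real.sin_le_one (r t))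
          linarith
        unfold alphaRHS
        linarith)
    rw [le_div_iff₀ hM]
    nlinarith
  have hr0S : r₀ ≤ r S := by rw [← h.hr0]; exact rmono le_rfl hS.le le_rfl
  refine ⟨hr0S, ?_⟩
  have hMi : 0 < 1 / M := one_div_pos.2 hM
  have hE : 0 < 4 * δ * Real.exp (2 * C) := by have := Real.exp_pos (2 * C); positivity
  rcases le_or_gt θ₁ (θ S) with hcase | hcase
  · have := claimA2 S (right_mem_Icc.2 hS.le) hcase
    linarith
  obtain ⟨s1, hs1, hs1e⟩ := intermediate_value_Icc' hS.le ct
    (show θ₁ ∈ Icc (θ S) (θ 0) from ⟨hcase.le, by rw [h.hθ0]; exact θ₁lt.le⟩)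
  have b1 := claimA2 s1 hs1 hs1e.ge
  have a1 := claimA s1 hs1 hs1e.ge
  rcases le_or_gt (α S) (-(Real.pi / 4)) with hc2 | hc2
  · have b2 := time1 hs1.1 hs1.2 le_rfl hc2
    have b3 := rlip hs1.1 hs1.2 le_rfl
    have := h.hθend
    rw [hs1e] at b2
    linarith
  obtain ⟨s2, hs2, hs2e⟩ := intermediate_value_Icc hs1.2 (ca.mono (sub hs1.1 le_rfl))
    (show -(Real.pi / 4) ∈ Icc (α s1) (α S) from ⟨a1.le, hc2.le⟩)
  have hs20 : 0 ≤ s2 := hs1.1.trans hs2.1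
  have b2 := time1 hs1.1 hs2.1 hs2.2 hs2e.le
  have b3 := rlip hs1.1 hs2.1 hs2.2
  have hθ2 : θ s2 ≤ θ₁ := hs1e ▸ tanti hs1.1 hs2.1 hs2.2
  have hθ3 := tanti hs20 hs2.2 le_rfl
  have b4 := claimC s2 ⟨hs20, hs2.2⟩ hθ2 hs2e.ge
  have b5 := rlip hs20 hs2.2 le_rfl
  have := h.hθend
  rw [hs1e] at b2
  linarith

/-- Writing `a(H) = arccot((−H)/(2n−1))`, the endpoint value `r(s∗)` of a monotone maximal
solution tends to `a(H)` as the initial value `r₀` tends to `a(H)`. -/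
theorem r_endpoint_tendsto (n : ℕ) (hn : 2 ≤ n) (H : ℝ) (hH : H < 0) :
    ∀ ε' > (0 : ℝ), ∃ η > (0 : ℝ),
      ∀ r₀ ∈ Ioo (0 : ℝ) (arccot (-H / (2 * (n : ℝ) - 1))),
        arccot (-H / (2 * (n : ℝ) - 1)) - r₀ < η →
        ∀ (r θ α : ℝ → ℝ) (sStar : ℝ),
          IsMonotoneMaximalSolution n H r θ α r₀ sStar →
          |r sStar - arccot (-H / (2 * (n : ℝ) - 1))| < ε' := by
  intro ε hε
  have hn' : (2 : ℝ) ≤ n := by exact_mod_cast hn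
  have hpi := Real.pi_gt_three
  set a := arccot (-H / (2 * (n : ℝ) - 1)) with ha
  have hm : 0 < 2 * (n : ℝ) - 1 := by linarith
  have hapos : 0 < a := by
    have := Real.arctan_lt_pi_div_two (-H / (2 * (n : ℝ) - 1))
    rw [ha, arccot]; linarith
  have halt : a < Real.pi / 2 := by
    have : 0 < Real.arctan (-H / (2 * (n : ℝ) - 1)) :=
      Real.arctan_pos.2 (div_pos (by linarith) hm)
    rw [ha, arccot]; linarith
  have hsina : 0 < Real.sin a := Real.sin_pos_of_pos_of_lt_pi hapos (by linarith)
  have hcota : (2 * (n : ℝ) - 1) * (Real.cos a / Real.sin a) = -H := by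
    have : Real.cos a / Real.sin a = -H / (2 * (n : ℝ) - 1) := by
      rw [ha, arccot, Real.cos_pi_div_two_sub, Real.sin_pi_div_two_sub,
        ← Real.tan_eq_sin_div_cos, Real.tan_arctan]
    rw [this]; field_simp
  set σ := Real.sin (a / 2) with hσd
  have hσ : 0 < σ := Real.sin_pos_of_pos_of_lt_pi (by linarith) (by linarith)
  set M := 4 / ε with hMd
  have hM : 0 < M := by positivity
  set c := 1 / (M - H) with hc
  set C := (2 * (n : ℝ) - 2) * (1 / c) / σ with hC
  set δ := min ε 1 / (16 * Real.exp (2 * C)) with hδd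
  have hexp := Real.exp_pos (2 * C)
  have hmin : 0 < min ε 1 := lt_min hε one_pos
  have hδ : 0 < δ := by positivity
  have hδe : δ * Real.exp (2 * C) = min ε 1 / 16 := by rw [hδd]; field_simp
  have hcle : c ≤ ε / 4 := by
    have : ε / 4 = 1 / M := by rw [hMd]; simp
    rw [this, hc]
    exact one_div_le_one_div_of_le hM (by linarith)
  have hMe : 1 / M = ε / 4 := by rw [hMd]; simp
  have hcont : ContinuousAt
      (fun x => (2 * (n : ℝ) - 1) * (Real.cos x / Real.sin x)) a :=
    continuousAt_const.mul
      (Real.continuous_cos.continuousAt.div Real.continuous_sin.continuousAt hsina.ne')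
  obtain ⟨η₀, hη₀, hη⟩ := Metric.continuousAt_iff.1 hcont δ hδ
  refine ⟨min η₀ (min (a / 2) ε), by positivity, ?_⟩
  intro r₀ hr₀ hlt r θ α S h
  have l1 := hlt.trans_le (min_le_left _ _)
  have l2 := hlt.trans_le ((min_le_right _ _).trans (min_le_left _ _))
  have l3 := hlt.trans_le ((min_le_right _ _).trans (min_le_right _ _))
  have hd := hη (x := r₀) (by rw [Real.dist_eq, abs_lt]; constructor <;> linarith [hr₀.2])
  simp only [Real.dist_eq, hcota] at hd
  have hd2 := (abs_lt.1 hd).2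
  have hb := endpoint_bound n hn H hH h hM hc hσ
    (Real.sin_le_sin_of_le_of_le_pi_div_two (by linarith) (by linarith [hr₀.2]) (by linarith))
    hδ (by linarith) hC (by
      have := min_le_right ε 1
      nlinarith)
  have hme := min_le_left ε 1
  have := hr₀.2
  rw [abs_lt]
  constructor
  · linarith [hb.1]
  · nlinarith [hb.2]
end

section
/- Let n ≥ 2. There exist real numbers r₀', r₀'' with 0 < r₀' < r₀'' < π/2 and δ with 0 < δ < (2n−1)·cot r₀'' such that for every H with −δ ≤ H ≤ 0: every monotone maximal solution (r, θ, α) on (0, s∗) of the CMC profile ODE system with parameter H and initial value r₀ = r₀' satisfies α(s∗) = 0, and every monotone maximal solution with initial value r₀ = r₀'' satisfies r(s∗) = π/2. -/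
open Real Set

lemma cmc_mono_aux {F F' : ℝ → ℝ} {a b : ℝ} (hab : a ≤ b) (hc : ContinuousOn F (Icc a b))
    (hd : ∀ s ∈ Ioo a b, HasDerivAt F (F' s) s) (h0 : ∀ s ∈ Ioo a b, 0 ≤ F' s) : F a ≤ F b := by
  have hm : MonotoneOn F (Icc a b) := by
    apply monotoneOn_of_deriv_nonneg (convex_Icc a b) hc
    · intro x hx
      rw [interior_Icc] at hx
      exact (hd x hx).differentiableAt.differentiableWithinAt
    · intro x hx
      rw [interior_Icc] at hx
      rw [(hd x hx).deriv]
      exact h0 x hx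
  exact hm (left_mem_Icc.2 hab) (right_mem_Icc.2 hab) hab

/-- The facts about a monotone maximal solution that are used below. -/
structure CMCFacts (n : ℕ) (H : ℝ) (r θ α : ℝ → ℝ) (r₀ S : ℝ) : Prop where
  hS : 0 < S
  cr : ContinuousOn r (Icc 0 S)
  ct : ContinuousOn θ (Icc 0 S)
  ca : ContinuousOn α (Icc 0 S)
  dr : ∀ s ∈ Ioo 0 S, HasDerivAt r (Real.cos (α s)) s
  dt : ∀ s ∈ Ioo 0 S, HasDerivAt θ (Real.sin (α s) / Real.sin (r s)) s
  da : ∀ s ∈ Ioo 0 S, HasDerivAt α (alphaRHS n H (r s) (θ s) (α s)) s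
  r0 : r 0 = r₀
  t0 : θ 0 = Real.pi / 4
  a0 : α 0 = -(Real.pi / 2)
  br : ∀ s ∈ Icc 0 S, r₀ ≤ r s ∧ r s ≤ Real.pi / 2
  bt : ∀ s ∈ Icc 0 S, 0 < θ s ∧ θ s ≤ Real.pi / 4
  ba : ∀ s ∈ Icc 0 S, -(Real.pi / 2) ≤ α s ∧ α s ≤ 0
  mr : MonotoneOn r (Icc 0 S)
  mt : AntitoneOn θ (Icc 0 S)
  ma : MonotoneOn α (Icc 0 S)
  r0pos : 0 < r₀

lemma cmc_facts {n : ℕ} {H : ℝ} {r θ α : ℝ → ℝ} {r₀ S : ℝ}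
    (h : IsMonotoneMaximalSolution n H r θ α r₀ S) : CMCFacts n H r θ α r₀ S := by
  have hS := h.hsStar
  have cr := h.hC1r.continuousOn
  have ct := h.hC1θ.continuousOn
  have ca := h.hC1α.continuousOn
  have hn : ∀ s ∈ Ioo 0 S, Ioo 0 S ∈ nhds s := fun s hs => isOpen_Ioo.mem_nhds hs
  have hn' : ∀ s ∈ Ioo 0 S, Icc 0 S ∈ nhds s := fun s hs =>
    Filter.mem_of_superset (hn s hs) Ioo_subset_Icc_self
  have dr : ∀ s ∈ Ioo 0 S, HasDerivAt r (Real.cos (α s)) s := fun s hs =>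
    (h.hsol s hs).2.2.1.hasDerivAt (hn s hs)
  have dt : ∀ s ∈ Ioo 0 S, HasDerivAt θ (Real.sin (α s) / Real.sin (r s)) s := fun s hs =>
    (h.hsol s hs).2.2.2.1.hasDerivAt (hn s hs)
  have da : ∀ s ∈ Ioo 0 S, HasDerivAt α (alphaRHS n H (r s) (θ s) (α s)) s := fun s hs =>
    (h.hsol s hs).2.2.2.2.hasDerivAt (hn s hs)
  have mr : MonotoneOn r (Icc 0 S) := by
    apply monotoneOn_of_deriv_nonneg (convex_Icc 0 S) cr
    · intro x hx
      rw [interior_Icc] at hx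
      exact (dr x hx).differentiableAt.differentiableWithinAt
    · intro x hx
      rw [interior_Icc] at hx
      rw [(dr x hx).deriv]
      have := (h.hval x hx).2.2
      exact Real.cos_nonneg_of_neg_pi_div_two_le_of_le this.1.le (by linarith [this.2, Real.pi_pos])
  have mt : AntitoneOn θ (Icc 0 S) := by
    apply antitoneOn_of_deriv_nonpos (convex_Icc 0 S) ct
    · intro x hx
      rw [interior_Icc] at hx
      exact (dt x hx).differentiableAt.differentiableWithinAt
    · intro x hx
      rw [interior_Icc] at hx
      rw [(dt x hx).deriv]
      have h1 := (h.hval x hx).2.2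
      have h2 := (h.hval x hx).1
      apply div_nonpos_of_nonpos_of_nonneg
      · exact Real.sin_nonpos_of_nonpos_of_neg_pi_le h1.2.le (by linarith [h1.1, Real.pi_pos])
      · exact Real.sin_nonneg_of_nonneg_of_le_pi h2.1.le (by linarith [h2.2, Real.pi_pos])
  have ma : MonotoneOn α (Icc 0 S) := by
    apply monotoneOn_of_deriv_nonneg (convex_Icc 0 S) ca
    · intro x hx
      rw [interior_Icc] at hx
      exact (da x hx).differentiableAt.differentiableWithinAt
    · intro x hx
      rw [interior_Icc] at hx
      rw [← derivWithin_of_mem_nhds (hn' x hx)]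
      exact (h.hαdot x hx).le
  have hcl : closure (Ioo 0 S) = Icc 0 S := closure_Ioo hS.ne
  have e0 : (0:ℝ) ∈ Icc 0 S := left_mem_Icc.2 hS.le
  have e1 : S ∈ Icc 0 S := right_mem_Icc.2 hS.le
  refine ⟨hS, cr, ct, ca, dr, dt, da, h.hr0, h.hθ0, h.hα0, ?_, ?_, ?_, mr, mt, ma, h.hr₀.1⟩
  · intro s hs
    refine ⟨?_, ?_⟩
    · rw [← h.hr0]; exact mr e0 hs hs.1
    · have hm : MapsTo r (Ioo 0 S) (Iic (Real.pi / 2)) := fun x hx => (h.hval x hx).1.2.le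
      have := hm.closure_of_continuousOn (by rwa [hcl])
      rw [hcl, closure_Iic] at this
      exact this hs
  · intro s hs
    refine ⟨lt_of_lt_of_le h.hθend (mt hs e1 hs.2), ?_⟩
    rw [← h.hθ0]; exact mt e0 hs hs.1
  · intro s hs
    refine ⟨?_, ?_⟩
    · rw [← h.hα0]; exact ma e0 hs hs.1
    · have hm : MapsTo α (Ioo 0 S) (Iic 0) := fun x hx => (h.hval x hx).2.2.2.le
      have := hm.closure_of_continuousOn (by rwa [hcl])
      rw [hcl, closure_Iic] at this
      exact this hs

lemma cmc_end {n : ℕ} {H : ℝ} {r θ α : ℝ → ℝ} {r₀ S k : ℝ}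
    (h : IsMonotoneMaximalSolution n H r θ α r₀ S) (hk : 0 < k)
    (hb : ∀ s ∈ Ioo 0 S, k ≤ alphaRHS n H (r s) (θ s) (α s)) : r S = Real.pi / 2 ∨ α S = 0 := by
  rcases h.hend with h1 | h1 | h1
  · exact Or.inl h1
  · exact Or.inr h1
  · exfalso
    have hS := h.hsStar
    have hc : ContinuousOn (derivWithin α (Icc 0 S)) (Icc 0 S) :=
      h.hC1α.continuousOn_derivWithin (uniqueDiffOn_Icc hS) le_rfl
    have hcl : closure (Ioo 0 S) = Icc 0 S := closure_Ioo hS.ne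
    have hm : MapsTo (derivWithin α (Icc 0 S)) (Ioo 0 S) (Ici k) := by
      intro x hx
      have hn' : Icc 0 S ∈ nhds x := 
        Filter.mem_of_superset (isOpen_Ioo.mem_nhds hx) Ioo_subset_Icc_self
      rw [derivWithin_of_mem_nhds hn', ((cmc_facts h).da x hx).deriv]
      exact hb x hx
    have := hm.closure_of_continuousOn (by rwa [hcl])
    rw [hcl, closure_Ici] at this
    have h2 := this (right_mem_Icc.2 hS.le)
    rw [h1] at h2
    exact absurd h2 (not_le.2 hk)

lemma alphaRHS_ge {n : ℕ} (hn : 2 ≤ n) {H rv t a : ℝ} (h1 : 0 < Real.sin rv) (h2 : 0 ≤ Real.cos rv)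
    (h3 : 0 < Real.sin (2 * t)) (h4 : 0 ≤ Real.cos (2 * t)) (h5 : 0 ≤ Real.cos a)
    (h6 : Real.sin a ≤ 0) :
    2 * (Real.cos (2 * t) / Real.sin (2 * t)) * Real.cos a / Real.sin rv
      + 3 * (Real.cos rv / Real.sin rv) * (- Real.sin a) + H ≤ alphaRHS n H rv t a := by
  have hN : (2:ℝ) ≤ n := by exact_mod_cast hn
  have e1 : 0 ≤ (Real.cos (2 * t) / Real.sin (2 * t)) * Real.cos a / Real.sin rv := by positivity
  have e2 : 0 ≤ (Real.cos rv / Real.sin rv) * (- Real.sin a) :=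
    mul_nonneg (by positivity) (by linarith)
  have e3 := mul_nonneg (sub_nonneg.2 hN) e1
  have e4 := mul_nonneg (sub_nonneg.2 hN) e2
  have : alphaRHS n H rv t a = 2 * (Real.cos (2 * t) / Real.sin (2 * t)) * Real.cos a / Real.sin rv
      + 3 * (Real.cos rv / Real.sin rv) * (- Real.sin a) + H
      + 2 * (((n:ℝ) - 2) * ((Real.cos (2 * t) / Real.sin (2 * t)) * Real.cos a / Real.sin rv))
      + 2 * (((n:ℝ) - 2) * ((Real.cos rv / Real.sin rv) * (- Real.sin a))) := by
    unfold alphaRHS; ring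
  linarith

lemma alphaRHS_le {n : ℕ} {H rv t a : ℝ} (hH : H ≤ 0) (h1 : 0 < Real.sin rv)
    (h2 : 0 ≤ Real.cos rv)
    (h3 : 0 < Real.sin (2 * t)) (h4 : 0 ≤ Real.cos (2 * t)) (h5 : 0 ≤ Real.cos a)
    (h6 : Real.sin a ≤ 0) :
    alphaRHS n H rv t a ≤
    2 * n * ((Real.cos (2 * t) / Real.sin (2 * t)) * Real.cos a
      + Real.cos rv * (- Real.sin a)) / Real.sin rv := by
  have e1 : 0 ≤ (Real.cos (2 * t) / Real.sin (2 * t)) * Real.cos a / Real.sin rv := by positivity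
  have e2 : 0 ≤ (Real.cos rv / Real.sin rv) * (- Real.sin a) :=
    mul_nonneg (by positivity) (by linarith)
  have : alphaRHS n H rv t a = 2 * n * ((Real.cos (2 * t) / Real.sin (2 * t)) * Real.cos a
      + Real.cos rv * (- Real.sin a)) / Real.sin rv + H
      - 2 * ((Real.cos (2 * t) / Real.sin (2 * t)) * Real.cos a / Real.sin rv)
      - ((Real.cos rv / Real.sin rv) * (- Real.sin a)) := by
    unfold alphaRHS; ring
  linarith

/-- Signs of the trigonometric quantities along a solution. -/
lemma CMCFacts.signs {n : ℕ} {H : ℝ} {r θ α : ℝ → ℝ} {r₀ S : ℝ}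
    (h : CMCFacts n H r θ α r₀ S) {s : ℝ} (hs : s ∈ Icc 0 S) :
    0 < Real.sin (r s) ∧ 0 ≤ Real.cos (r s) ∧ 0 < Real.sin (2 * θ s) ∧ 0 ≤ Real.cos (2 * θ s) ∧
    0 ≤ Real.cos (α s) ∧ Real.sin (α s) ≤ 0 := by
  have hp := Real.pi_pos
  obtain ⟨a1, a2⟩ := h.br s hs
  obtain ⟨b1, b2⟩ := h.bt s hs
  obtain ⟨c1, c2⟩ := h.ba s hs
  have := h.r0pos
  refine ⟨?_, ?_, ?_, ?_, ?_, ?_⟩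
  · exact Real.sin_pos_of_pos_of_lt_pi (by linarith) (by linarith)
  · exact Real.cos_nonneg_of_neg_pi_div_two_le_of_le (by linarith) (by linarith)
  · exact Real.sin_pos_of_pos_of_lt_pi (by linarith) (by linarith)
  · exact Real.cos_nonneg_of_neg_pi_div_two_le_of_le (by linarith) (by linarith)
  · exact Real.cos_nonneg_of_neg_pi_div_two_le_of_le (by linarith) (by linarith)
  · exact Real.sin_nonpos_of_nonpos_of_neg_pi_le (by linarith) (by linarith)

lemma cmc_half_le_sin {x : ℝ} (h0 : 0 ≤ x) (h1 : x ≤ Real.pi / 2) : x / 2 ≤ Real.sin x := by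
  have h := Real.mul_le_sin h0 h1
  have hp := Real.pi_pos
  have h4 := Real.pi_le_four
  have : (1:ℝ) / 2 ≤ 2 / Real.pi := by
    rw [div_le_div_iff₀ (by norm_num) hp]; linarith
  nlinarith

lemma cmc_cos_two_ge {t : ℝ} (h0 : 0 ≤ t) (h1 : t ≤ Real.pi / 4) :
    Real.pi / 4 - t ≤ Real.cos (2 * t) := by
  rw [← Real.sin_pi_div_two_sub]
  have := cmc_half_le_sin (x := Real.pi / 2 - 2 * t) (by linarith) (by linarith)
  linarith

lemma cmc_cot_ge {t : ℝ} (h0 : 0 < t) (h1 : t ≤ Real.pi / 4) :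
    Real.pi / 4 - t ≤ Real.cos (2 * t) / Real.sin (2 * t) := by
  have hp := Real.pi_pos
  have hs : 0 < Real.sin (2 * t) := Real.sin_pos_of_pos_of_lt_pi (by linarith) (by linarith)
  have h2 := cmc_cos_two_ge h0.le h1
  rw [le_div_iff₀ hs]
  nlinarith [Real.sin_le_one (2 * t)]

set_option maxHeartbeats 1000000 in
lemma cmc_one_small {n : ℕ} (hn : 2 ≤ n) {H : ℝ} {r θ α : ℝ → ℝ} {r₀ S : ℝ}
    (h : CMCFacts n H r θ α r₀ S) (hH0 : H ≤ 0) (hH : -(1 / (16 * (n:ℝ))) ≤ H) {s : ℝ}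
    (hs : s ∈ Ioo 0 S) (hr : r s ≤ Real.pi / 3) :
    1 / (16 * (n:ℝ)) / Real.sin (r s) ≤ alphaRHS n H (r s) (θ s) (α s) := by
  have hp := Real.pi_pos
  have hp3 := Real.pi_gt_three
  have hN : (2:ℝ) ≤ n := by exact_mod_cast hn
  have hsI : s ∈ Icc 0 S := Ioo_subset_Icc_self hs
  obtain ⟨g1, g2, g3, g4, g5, g6⟩ := h.signs hsI
  have hge := alphaRHS_ge hn (H := H) g1 g2 g3 g4 g5 g6
  set δ := 1 / (16 * (n:ℝ)) with hδ
  have hδ0 : 0 < δ := by positivity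
  have hδ1 : δ ≤ 1 / 32 := by
    rw [hδ]; apply one_div_le_one_div_of_le <;> linarith
  obtain ⟨a1, a2⟩ := h.br s hsI
  obtain ⟨b1, b2⟩ := h.bt s hsI
  obtain ⟨c1, c2⟩ := h.ba s hsI
  have hcr : 1 / 2 ≤ Real.cos (r s) := by
    rw [← Real.cos_pi_div_three]
    apply Real.cos_le_cos_of_nonneg_of_le_pi _ _ hr <;> linarith [h.r0pos]
  have hsr1 := Real.sin_le_one (r s)
  have hHs : -δ ≤ H * Real.sin (r s) := by nlinarith
  rw [div_le_iff₀ g1]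
  have hge2 := mul_le_mul_of_nonneg_right hge g1.le
  have e : (2 * (Real.cos (2 * θ s) / Real.sin (2 * θ s)) * Real.cos (α s) / Real.sin (r s)
      + 3 * (Real.cos (r s) / Real.sin (r s)) * (- Real.sin (α s)) + H) * Real.sin (r s)
      = 2 * ((Real.cos (2 * θ s) / Real.sin (2 * θ s)) * Real.cos (α s))
        + 3 * (Real.cos (r s) * (- Real.sin (α s))) + H * Real.sin (r s) := by
    have := g1.ne'
    field_simp
  rw [e] at hge2
  have p1 : 0 ≤ (Real.cos (2 * θ s) / Real.sin (2 * θ s)) * Real.cos (α s) := by positivity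
  have p2 : 0 ≤ Real.cos (r s) * (- Real.sin (α s)) := mul_nonneg g2 (by linarith)
  by_cases hα : α s ≤ -(Real.pi / 6)
  · have : 1 / 2 ≤ - Real.sin (α s) := by
      rw [← Real.sin_neg, ← Real.sin_pi_div_six]
      apply Real.sin_le_sin_of_le_of_le_pi_div_two <;> linarith
    nlinarith
  · push Not at hα
    have hca : 1 / 2 ≤ Real.cos (α s) := by
      rw [← Real.cos_pi_div_three, ← Real.cos_neg (α s)]
      apply Real.cos_le_cos_of_nonneg_of_le_pi <;> linarith
    have hsub : Icc 0 s ⊆ Icc 0 S := Icc_subset_Icc_right hs.2.le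
    obtain ⟨s1, hs1, hs1e⟩ : -(Real.pi / 6) ∈ α '' Icc 0 s := by
      apply intermediate_value_Icc hs.1.le (h.ca.mono hsub)
      rw [h.a0]; constructor <;> linarith
    have hs1I := hsub hs1
    have hphi : 1 / (8 * (n:ℝ)) ≤ Real.pi / 4 - θ s1 := by
      have h8 : 1 / (8 * (n:ℝ)) ≤ 1 / 16 := by
        apply one_div_le_one_div_of_le <;> linarith
      by_cases ht : θ s1 ≤ Real.pi / 8
      · linarith
      · push Not at ht
        have hsub1 : Icc 0 s1 ⊆ Icc 0 S := Icc_subset_Icc_right hs1I.2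
        have hsub2 : Ioo 0 s1 ⊆ Ioo 0 S := Ioo_subset_Ioo_right hs1I.2
        have := cmc_mono_aux (F := fun u => - (8 * (n:ℝ)) * θ u - α u)
          (F' := fun u => - (8 * (n:ℝ)) * (Real.sin (α u) / Real.sin (r u))
            - alphaRHS n H (r u) (θ u) (α u)) hs1.1
          ((continuousOn_const.mul (h.ct.mono hsub1)).sub (h.ca.mono hsub1))
          (fun u hu => ((h.dt u (hsub2 hu)).const_mul _).sub (h.da u (hsub2 hu))) (by
            intro u hu
            have huI : u ∈ Icc 0 S := Ioo_subset_Icc_self (hsub2 hu)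
            obtain ⟨q1, q2, q3, q4, q5, q6⟩ := h.signs huI
            have hle := alphaRHS_le (n := n) hH0 q1 q2 q3 q4 q5 q6
            have htu : Real.pi / 8 ≤ θ u := ht.le.trans (h.mt huI hs1I hu.2.le)
            have hau : α u ≤ -(Real.pi / 6) := hs1e ▸ h.ma huI hs1I hu.2.le
            have k1 : 1 / 2 ≤ - Real.sin (α u) := by
              rw [← Real.sin_neg, ← Real.sin_pi_div_six]
              apply Real.sin_le_sin_of_le_of_le_pi_div_two <;> linarith [(h.ba u huI).1]
            have k2 : Real.cos (2 * θ u) / Real.sin (2 * θ u) ≤ 1 := by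
              rw [div_le_one q3, ← Real.sin_pi_div_two_sub]
              apply Real.sin_le_sin_of_le_of_le_pi_div_two <;> linarith [(h.bt u huI).2]
            have k3 : (Real.cos (2 * θ u) / Real.sin (2 * θ u)) * Real.cos (α u)
                + Real.cos (r u) * (- Real.sin (α u)) ≤ 4 * (- Real.sin (α u)) := by
              have := Real.cos_le_one (α u)
              have := Real.cos_le_one (r u)
              have z1 : (Real.cos (2 * θ u) / Real.sin (2 * θ u)) * Real.cos (α u) ≤ 1 := by
                have : 0 ≤ Real.cos (2 * θ u) / Real.sin (2 * θ u) := by positivity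
                nlinarith
              have z2 : Real.cos (r u) * (- Real.sin (α u)) ≤ 1 * (- Real.sin (α u)) :=
                mul_le_mul_of_nonneg_right this (by linarith)
              linarith
            have k4 : 2 * n * ((Real.cos (2 * θ u) / Real.sin (2 * θ u)) * Real.cos (α u)
                + Real.cos (r u) * (- Real.sin (α u))) / Real.sin (r u)
                ≤ - (8 * (n:ℝ)) * (Real.sin (α u) / Real.sin (r u)) := by
              rw [← mul_div_assoc]
              apply div_le_div_of_nonneg_right _ q1.le
              have := mul_le_mul_of_nonneg_left k3 (by positivity : 0 ≤ 2 * (n:ℝ))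
              linarith
            linarith)
        simp only [h.t0, h.a0, hs1e] at this
        rw [div_le_iff₀ (by positivity)]
        linarith
    have hth : θ s ≤ θ s1 := h.mt hs1I hsI hs1.2
    have hcot := cmc_cot_ge b1 b2
    have h8 : 1 / (8 * (n:ℝ)) = 2 * δ := by rw [hδ]; field_simp; norm_num
    have w1 : 2 * δ * (1 / 2) ≤
        (Real.cos (2 * θ s) / Real.sin (2 * θ s)) * Real.cos (α s) :=
      mul_le_mul (by linarith) hca (by norm_num) (by positivity)
    linarith

lemma cmc_part_one {n : ℕ} (hn : 2 ≤ n) {H : ℝ} (hH0 : H ≤ 0) (hH : -(1 / (16 * (n:ℝ))) ≤ H)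
    {r θ α : ℝ → ℝ} {S : ℝ}
    (hm : IsMonotoneMaximalSolution n H r θ α
      (Real.pi / 4 * Real.exp (-(8 * (n:ℝ) * Real.pi))) S) : α S = 0 := by
  have hp := Real.pi_pos
  have h := cmc_facts hm
  have hN : (2:ℝ) ≤ n := by exact_mod_cast hn
  have hδ0 : 0 < 1 / (16 * (n:ℝ)) := by positivity
  have hSI := right_mem_Icc.2 h.hS.le
  have hr3 : r S < Real.pi / 3 := by
    by_contra hcon
    push Not at hcon
    have hr0 : r 0 ≤ Real.pi / 3 := by
      rw [h.r0]
      have : Real.exp (-(8 * (n:ℝ) * Real.pi)) ≤ 1 := Real.exp_le_one_iff.2 (by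
        have : 0 ≤ 8 * (n:ℝ) * Real.pi := by positivity
        linarith)
      nlinarith
    obtain ⟨s1, hs1, hs1e⟩ : Real.pi / 3 ∈ r '' Icc 0 S :=
      intermediate_value_Icc h.hS.le h.cr ⟨hr0, hcon⟩
    have hsub1 : Icc 0 s1 ⊆ Icc 0 S := Icc_subset_Icc_right hs1.2
    have hsub2 : Ioo 0 s1 ⊆ Ioo 0 S := Ioo_subset_Ioo_right hs1.2
    have hrp : ∀ u ∈ Icc 0 S, 0 < r u := fun u hu => h.r0pos.trans_le (h.br u hu).1
    have := cmc_mono_aux (F := fun u => α u - 1 / (16 * (n:ℝ)) * Real.log (r u))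
      (F' := fun u => alphaRHS n H (r u) (θ u) (α u)
          - 1 / (16 * (n:ℝ)) * (Real.cos (α u) / r u)) hs1.1
      ((h.ca.mono hsub1).sub (continuousOn_const.mul
        ((h.cr.mono hsub1).log (fun u hu => (hrp u (hsub1 hu)).ne'))))
      (fun u hu => (h.da u (hsub2 hu)).sub (((h.dr u (hsub2 hu)).log
        (hrp u (Ioo_subset_Icc_self (hsub2 hu))).ne').const_mul _)) (by
        intro u hu
        have huI : u ∈ Icc 0 S := Ioo_subset_Icc_self (hsub2 hu)
        have hru : r u ≤ Real.pi / 3 := hs1e ▸ h.mr huI hs1 hu.2.le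
        have key := cmc_one_small hn h hH0 hH (hsub2 hu) hru
        obtain ⟨q1, q2, q3, q4, q5, q6⟩ := h.signs huI
        have hrpu := hrp u huI
        have k1 : Real.cos (α u) / r u ≤ 1 / Real.sin (r u) :=
          div_le_div₀ zero_le_one (Real.cos_le_one _) q1 (Real.sin_le hrpu.le)
        have k2 := mul_le_mul_of_nonneg_left k1 hδ0.le
        rw [mul_one_div] at k2
        linarith)
    simp only [h.r0, h.a0, hs1e] at this
    rw [Real.log_mul (by positivity) (Real.exp_pos _).ne', Real.log_exp] at this
    have ha := (h.ba s1 hs1).2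
    have hlog : Real.log (Real.pi / 4) < Real.log (Real.pi / 3) :=
      Real.log_lt_log (by positivity) (by linarith)
    have e : 1 / (16 * (n:ℝ)) * (8 * (n:ℝ) * Real.pi) = Real.pi / 2 := by field_simp; norm_num
    have := mul_pos hδ0 (sub_pos.2 hlog)
    nlinarith
  rcases cmc_end hm hδ0 (by
    intro s hs
    have hsI : s ∈ Icc 0 S := Ioo_subset_Icc_self hs
    have hrs : r s ≤ Real.pi / 3 := (h.mr hsI hSI hs.2.le).trans hr3.le
    refine le_trans ?_ (cmc_one_small hn h hH0 hH hs hrs)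
    rw [le_div_iff₀ (h.signs hsI).1]
    nlinarith [Real.sin_le_one (r s)]) with h1 | h1
  · linarith
  · exact h1

lemma cmc_gronwall_aux {n : ℕ} {H : ℝ} {r θ α : ℝ → ℝ} {ε S M T : ℝ}
    (h : CMCFacts n H r θ α (Real.pi / 2 - ε) S) (hH0 : H ≤ 0) (hM : 1 ≤ M)
    (hT : T ∈ Icc 0 S) (hε : 0 < ε)
    (hcot : ∀ u ∈ Icc 0 T, Real.cos (2 * θ u) / Real.sin (2 * θ u) ≤ M)
    (hα : α T ≤ -(Real.pi / 6)) :
    α T + Real.pi / 2 ≤ ε * Real.exp (n * M * Real.pi) := by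
  have hp := Real.pi_pos
  have hsub1 : Icc 0 T ⊆ Icc 0 S := Icc_subset_Icc_right hT.2
  have hsub2 : Ioo 0 T ⊆ Ioo 0 S := Ioo_subset_Ioo_right hT.2
  have key := cmc_mono_aux
    (F := fun u => - ((α u + (Real.pi / 2 + ε)) * Real.exp (4 * n * M * θ u)))
    (F' := fun u => - (alphaRHS n H (r u) (θ u) (α u) * Real.exp (4 * n * M * θ u)
      + (α u + (Real.pi / 2 + ε)) * (Real.exp (4 * n * M * θ u)
        * (4 * n * M * (Real.sin (α u) / Real.sin (r u)))))) hT.1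
    ((((h.ca.mono hsub1).add continuousOn_const).mul
      ((continuousOn_const.mul (h.ct.mono hsub1)).rexp)).neg)
    (fun u hu => (((h.da u (hsub2 hu)).add_const _).mul
      (((h.dt u (hsub2 hu)).const_mul _).exp)).neg) (by
      intro u hu
      have huT : u ∈ Icc 0 T := Ioo_subset_Icc_self hu
      have huI := hsub1 huT
      obtain ⟨q1, q2, q3, q4, q5, q6⟩ := h.signs huI
      have hle := alphaRHS_le (n := n) hH0 q1 q2 q3 q4 q5 q6
      have hau : α u ≤ -(Real.pi / 6) := (h.ma huI hT hu.2.le).trans hα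
      have hbu := (h.ba u huI).1
      have k1 : 1 / 2 ≤ - Real.sin (α u) := by
        rw [← Real.sin_neg, ← Real.sin_pi_div_six]
        apply Real.sin_le_sin_of_le_of_le_pi_div_two <;> linarith
      have k2 : Real.cos (α u) ≤ α u + Real.pi / 2 := by
        rw [← Real.sin_add_pi_div_two]
        exact Real.sin_le (by linarith)
      have k3 : Real.cos (r u) ≤ ε := by
        rw [← Real.sin_pi_div_two_sub]
        have := (h.br u huI)
        exact (Real.sin_le (by linarith [this.2])).trans (by linarith [this.1])
      have k4 := hcot u huT
      have k5 : (Real.cos (2 * θ u) / Real.sin (2 * θ u)) * Real.cos (α u)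
          ≤ M * (α u + Real.pi / 2) := mul_le_mul k4 k2 q5 (by linarith)
      have k6 : Real.cos (r u) * (- Real.sin (α u)) ≤ M * ε := by
        have : - Real.sin (α u) ≤ 1 := by linarith [Real.neg_one_le_sin (α u)]
        have : Real.cos (r u) * (- Real.sin (α u)) ≤ ε * 1 :=
          mul_le_mul k3 this (by linarith) hε.le
        nlinarith
      have k7 : 0 ≤ M * (α u + (Real.pi / 2 + ε)) := mul_nonneg (by linarith) (by linarith)
      have k8 : (Real.cos (2 * θ u) / Real.sin (2 * θ u)) * Real.cos (α u)
          + Real.cos (r u) * (- Real.sin (α u))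
          ≤ 2 * (M * (α u + (Real.pi / 2 + ε)) * (- Real.sin (α u))) := by
        have := mul_le_mul_of_nonneg_left k1 k7
        linarith
      have k9 : 2 * n * ((Real.cos (2 * θ u) / Real.sin (2 * θ u)) * Real.cos (α u)
          + Real.cos (r u) * (- Real.sin (α u))) / Real.sin (r u)
          ≤ (4 * n * M * (α u + (Real.pi / 2 + ε)) * (- Real.sin (α u))) / Real.sin (r u) := by
        apply div_le_div_of_nonneg_right _ q1.le
        have := mul_le_mul_of_nonneg_left k8 (by positivity : 0 ≤ 2 * (n:ℝ))
        linarith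
      have k10 : 0 ≤ (4 * n * M * (α u + (Real.pi / 2 + ε)) * (- Real.sin (α u))) / Real.sin (r u)
          - alphaRHS n H (r u) (θ u) (α u) := by linarith
      have := mul_nonneg k10 (Real.exp_pos (4 * n * M * θ u)).le
      refine this.trans (le_of_eq ?_)
      ring)
  simp only [h.t0, h.a0] at key
  have e1 : 4 * n * M * (Real.pi / 4) = n * M * Real.pi := by ring
  rw [e1] at key
  have hbT := (h.ba T hT).1
  have h1 : 1 ≤ Real.exp (4 * n * M * θ T) := by
    apply Real.one_le_exp
    have := (h.bt T hT).1
    positivity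
  have h2 : (α T + (Real.pi / 2 + ε)) * 1 ≤ (α T + (Real.pi / 2 + ε)) * Real.exp (4 * n * M * θ T) :=
    mul_le_mul_of_nonneg_left h1 (by linarith)
  have e2 : (-(Real.pi / 2) + (Real.pi / 2 + ε)) * Real.exp (n * M * Real.pi)
    = ε * Real.exp (n * M * Real.pi) := by ring
  linarith

lemma cmc_gronwall {n : ℕ} {H : ℝ} {r θ α : ℝ → ℝ} {ε S M T : ℝ}
    (h : CMCFacts n H r θ α (Real.pi / 2 - ε) S) (hH0 : H ≤ 0) (hM : 1 ≤ M)
    (hT : T ∈ Icc 0 S) (hε : 0 < ε) (hε1 : ε * Real.exp (n * M * Real.pi) ≤ 1)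
    (hcot : ∀ u ∈ Icc 0 T, Real.cos (2 * θ u) / Real.sin (2 * θ u) ≤ M) :
    α T + Real.pi / 2 ≤ ε * Real.exp (n * M * Real.pi) := by
  have hp := Real.pi_gt_three
  by_cases hα : α T ≤ -(Real.pi / 6)
  · exact cmc_gronwall_aux h hH0 hM hT hε hcot hα
  · push Not at hα
    have hsub1 : Icc 0 T ⊆ Icc 0 S := Icc_subset_Icc_right hT.2
    obtain ⟨s1, hs1, hs1e⟩ : -(Real.pi / 6) ∈ α '' Icc 0 T := by
      apply intermediate_value_Icc hT.1 (h.ca.mono hsub1)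
      rw [h.a0]; constructor <;> linarith
    have := cmc_gronwall_aux h hH0 hM (hsub1 hs1) hε
      (fun u hu => hcot u ⟨hu.1, hu.2.trans hs1.2⟩) hs1e.le
    linarith

lemma cmc_sin_half {n : ℕ} {H : ℝ} {r θ α : ℝ → ℝ} {ε S u : ℝ}
    (h : CMCFacts n H r θ α (Real.pi / 2 - ε) S) (hε2 : ε ≤ 1 / 2) (hu : u ∈ Icc 0 S) :
    1 / 2 ≤ Real.sin (r u) := by
  have hp := Real.pi_gt_three
  have := h.br u hu
  rw [← Real.sin_pi_div_six]
  apply Real.sin_le_sin_of_le_of_le_pi_div_two <;> linarith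

/-- Phase A: as long as `θ` is close to `π/4`, the curve is close to the initial position. -/
lemma cmc_phaseA {n : ℕ} {H : ℝ} {r θ α : ℝ → ℝ} {ε S T φ : ℝ}
    (h : CMCFacts n H r θ α (Real.pi / 2 - ε) S) (hH0 : H ≤ 0)
    (hT : T ∈ Icc 0 S) (hε : 0 < ε) (hε1 : ε * Real.exp (n * 1 * Real.pi) ≤ 1)
    (hφ : φ = 1 / (4 * Real.exp (n * 1 * Real.pi))) (hθ : Real.pi / 4 - φ ≤ θ T) :
    α T + Real.pi / 2 ≤ 1 ∧ r T ≤ Real.pi / 2 - ε / 2 ∧ Real.pi / 8 ≤ θ T := by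
  have hp := Real.pi_gt_three
  have hC1 : 1 ≤ Real.exp (n * 1 * Real.pi) := Real.one_le_exp (by positivity)
  set C := Real.exp (n * 1 * Real.pi) with hC
  have hφ1 : φ ≤ 1 / 4 := by
    rw [hφ]; apply one_div_le_one_div_of_le <;> linarith
  have hφC : C * φ = 1 / 4 := by
    rw [hφ]; field_simp
  have hsub1 : Icc 0 T ⊆ Icc 0 S := Icc_subset_Icc_right hT.2
  have hsub2 : Ioo 0 T ⊆ Ioo 0 S := Ioo_subset_Ioo_right hT.2
  have hcot : ∀ u ∈ Icc 0 T, Real.cos (2 * θ u) / Real.sin (2 * θ u) ≤ 1 := by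
    intro u hu
    have huI := hsub1 hu
    rw [div_le_one (h.signs huI).2.2.1, ← Real.sin_pi_div_two_sub]
    have := h.mt huI hT hu.2
    apply Real.sin_le_sin_of_le_of_le_pi_div_two <;> linarith [(h.bt u huI).2]
  have hg : ∀ u ∈ Icc 0 T, α u + Real.pi / 2 ≤ ε * C := fun u hu =>
    cmc_gronwall h hH0 le_rfl (hsub1 hu) hε hε1 (fun v hv => hcot v ⟨hv.1, hv.2.trans hu.2⟩)
  refine ⟨(hg T ⟨hT.1, le_rfl⟩).trans hε1, ?_, by linarith⟩
  have key := cmc_mono_aux (F := fun u => - (r u + 2 * (ε * C) * θ u))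
    (F' := fun u => - (Real.cos (α u) + 2 * (ε * C) * (Real.sin (α u) / Real.sin (r u)))) hT.1
    (((h.cr.mono hsub1).add (continuousOn_const.mul (h.ct.mono hsub1))).neg)
    (fun u hu => ((h.dr u (hsub2 hu)).add ((h.dt u (hsub2 hu)).const_mul _)).neg) (by
      intro u hu
      have huT : u ∈ Icc 0 T := Ioo_subset_Icc_self hu
      have huI := hsub1 huT
      obtain ⟨q1, q2, q3, q4, q5, q6⟩ := h.signs huI
      have hbu := (h.ba u huI).1
      have hgu := hg u huT
      have k1 : 1 / 2 ≤ - Real.sin (α u) := by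
        rw [← Real.sin_neg, ← Real.sin_pi_div_six]
        apply Real.sin_le_sin_of_le_of_le_pi_div_two <;> linarith
      have k2 : Real.cos (α u) ≤ α u + Real.pi / 2 := by
        rw [← Real.sin_add_pi_div_two]
        exact Real.sin_le (by linarith)
      have k3 : 1 / 2 ≤ - Real.sin (α u) / Real.sin (r u) := by
        rw [le_div_iff₀ q1]
        nlinarith [Real.sin_le_one (r u)]
      have k4 := mul_le_mul_of_nonneg_left k3 (by positivity : 0 ≤ 2 * (ε * C))
      rw [neg_div] at k4
      linarith)
  simp only [h.t0, h.r0] at key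
  have h1 : 2 * (ε * C) * (Real.pi / 4 - θ T) ≤ 2 * (ε * C) * φ :=
    mul_le_mul_of_nonneg_left (by linarith) (by positivity)
  have h2 : 2 * (ε * C) * φ = ε / 2 := by
    have : 2 * (ε * C) * φ = 2 * ε * (C * φ) := by ring
    rw [this, hφC]; ring
  linarith

/-- The quantity `v = sin 2θ · cos α` and a lower bound for its derivative. -/
lemma cmc_v_deriv {n : ℕ} (hn : 2 ≤ n) {H : ℝ} {r θ α : ℝ → ℝ} {r₀ S u : ℝ}
    (h : CMCFacts n H r θ α r₀ S) (hu : u ∈ Ioo 0 S) :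
    HasDerivAt (fun s => Real.sin (2 * θ s) * Real.cos (α s))
      (Real.cos (2 * θ u) * (2 * (Real.sin (α u) / Real.sin (r u))) * Real.cos (α u)
        + Real.sin (2 * θ u) * (- Real.sin (α u) * alphaRHS n H (r u) (θ u) (α u))) u ∧
    Real.sin (2 * θ u) * (- Real.sin (α u)) *
      (3 * (Real.cos (r u) / Real.sin (r u)) * (- Real.sin (α u)) + H) ≤
      (Real.cos (2 * θ u) * (2 * (Real.sin (α u) / Real.sin (r u))) * Real.cos (α u)
        + Real.sin (2 * θ u) * (- Real.sin (α u) * alphaRHS n H (r u) (θ u) (α u))) := by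
  refine ⟨(((h.dt u hu).const_mul 2).sin).mul ((h.da u hu).cos), ?_⟩
  obtain ⟨q1, q2, q3, q4, q5, q6⟩ := h.signs (Ioo_subset_Icc_self hu)
  have hge := alphaRHS_ge hn (H := H) q1 q2 q3 q4 q5 q6
  have := mul_le_mul_of_nonneg_left hge
    (mul_nonneg q3.le (by linarith : 0 ≤ - Real.sin (α u)))
  have e : Real.sin (2 * θ u) * (- Real.sin (α u)) *
      (2 * (Real.cos (2 * θ u) / Real.sin (2 * θ u)) * Real.cos (α u) / Real.sin (r u)
      + 3 * (Real.cos (r u) / Real.sin (r u)) * (- Real.sin (α u)) + H) =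
      Real.sin (2 * θ u) * (- Real.sin (α u)) *
      (3 * (Real.cos (r u) / Real.sin (r u)) * (- Real.sin (α u)) + H)
      - Real.cos (2 * θ u) * (2 * (Real.sin (α u) / Real.sin (r u))) * Real.cos (α u) := by
    have h1 := q1.ne'
    have h3 := q3.ne'
    field_simp
    ring
  rw [e] at this
  linarith

lemma cmc_v_cont {n : ℕ} {H : ℝ} {r θ α : ℝ → ℝ} {r₀ S : ℝ}
    (h : CMCFacts n H r θ α r₀ S) :
    ContinuousOn (fun s => Real.sin (2 * θ s) * Real.cos (α s)) (Icc 0 S) :=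
  (Real.continuous_sin.comp_continuousOn (continuousOn_const.mul h.ct)).mul
    (Real.continuous_cos.comp_continuousOn h.ca)

/-- In phase A the quantity `v` grows. -/
lemma cmc_vA {n : ℕ} (hn : 2 ≤ n) {H : ℝ} {r θ α : ℝ → ℝ} {ε S T φ : ℝ}
    (h : CMCFacts n H r θ α (Real.pi / 2 - ε) S) (hH0 : H ≤ 0)
    (hT : T ∈ Icc 0 S) (hε : 0 < ε) (hε1 : ε * Real.exp (n * 1 * Real.pi) ≤ 1)
    (hε2 : ε ≤ 1 / 2) (hH : -(ε / 8) ≤ H)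
    (hφ : φ = 1 / (4 * Real.exp (n * 1 * Real.pi))) (hθ : Real.pi / 4 - φ ≤ θ T) :
    ε / 16 * (Real.pi / 4 - θ T) ≤ Real.sin (2 * θ T) * Real.cos (α T) := by
  have hp := Real.pi_gt_three
  have hsub1 : Icc 0 T ⊆ Icc 0 S := Icc_subset_Icc_right hT.2
  have hsub2 : Ioo 0 T ⊆ Ioo 0 S := Ioo_subset_Ioo_right hT.2
  have key := cmc_mono_aux
    (F := fun u => Real.sin (2 * θ u) * Real.cos (α u) + ε / 16 * θ u)
    (F' := fun u => (Real.cos (2 * θ u) * (2 * (Real.sin (α u) / Real.sin (r u))) * Real.cos (α u)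
        + Real.sin (2 * θ u) * (- Real.sin (α u) * alphaRHS n H (r u) (θ u) (α u)))
        + ε / 16 * (Real.sin (α u) / Real.sin (r u))) hT.1
    (((cmc_v_cont h).mono hsub1).add (continuousOn_const.mul (h.ct.mono hsub1)))
    (fun u hu => (cmc_v_deriv hn h (hsub2 hu)).1.add ((h.dt u (hsub2 hu)).const_mul _)) (by
      intro u hu
      have huT : u ∈ Icc 0 T := Ioo_subset_Icc_self hu
      have huI := hsub1 huT
      obtain ⟨q1, q2, q3, q4, q5, q6⟩ := h.signs huI
      have hbu := (h.ba u huI).1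
      obtain ⟨A1, A2, A3⟩ := cmc_phaseA h hH0 huI hε hε1 hφ (hθ.trans (h.mt huI hT hu.2.le))
      have hd := (cmc_v_deriv hn h (hsub2 hu)).2
      have k1 : 1 / 2 ≤ - Real.sin (α u) := by
        rw [← Real.sin_neg, ← Real.sin_pi_div_six]
        apply Real.sin_le_sin_of_le_of_le_pi_div_two <;> linarith
      have k2 : ε / 4 ≤ Real.cos (r u) := by
        rw [← Real.sin_pi_div_two_sub]
        have := (h.br u huI)
        have := cmc_half_le_sin (x := Real.pi / 2 - r u) (by linarith) (by linarith)
        linarith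
      have k3 : ε / 4 ≤ Real.cos (r u) / Real.sin (r u) := by
        rw [le_div_iff₀ q1]
        nlinarith [Real.sin_le_one (r u)]
      have k4 : 1 / 2 ≤ Real.sin (2 * θ u) := by
        rw [← Real.sin_pi_div_six]
        apply Real.sin_le_sin_of_le_of_le_pi_div_two <;> linarith [(h.bt u huI).2]
      have k5 : ε / 4 * (1 / 2) ≤ (Real.cos (r u) / Real.sin (r u)) * (- Real.sin (α u)) :=
        mul_le_mul k3 k1 (by norm_num) (by linarith)
      have k6 : ε / 4 ≤ 3 * (Real.cos (r u) / Real.sin (r u)) * (- Real.sin (α u)) + H := by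
        linarith
      have k7 : 1 / 2 * (- Real.sin (α u)) * (ε / 4) ≤ Real.sin (2 * θ u) * (- Real.sin (α u)) *
          (3 * (Real.cos (r u) / Real.sin (r u)) * (- Real.sin (α u)) + H) :=
        mul_le_mul (mul_le_mul_of_nonneg_right k4 (by linarith)) k6 (by positivity)
          (mul_nonneg q3.le (by linarith))
      have k8 := cmc_sin_half h hε2 huI
      have k9 : - Real.sin (α u) / Real.sin (r u) ≤ 2 * (- Real.sin (α u)) := by
        rw [div_le_iff₀ q1]
        nlinarith
      have k10 := mul_le_mul_of_nonneg_left k9 (by positivity : 0 ≤ ε / 16)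
      rw [neg_div] at k10
      linarith)
  simp only [h.t0, h.a0, Real.cos_neg, Real.cos_pi_div_two] at key
  linarith

/-- The quantity `v` does not decrease much afterwards. -/
lemma cmc_vB {n : ℕ} (hn : 2 ≤ n) {H : ℝ} {r θ α : ℝ → ℝ} {r₀ S T s0 δ : ℝ}
    (h : CMCFacts n H r θ α r₀ S) (hs0 : s0 ∈ Icc 0 S)
    (hT : T ∈ Icc 0 S) (hsT : s0 ≤ T) (hδ : 0 ≤ δ) (hH : -δ ≤ H) :
    Real.sin (2 * θ s0) * Real.cos (α s0) - δ ≤ Real.sin (2 * θ T) * Real.cos (α T) := by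
  have hp := Real.pi_le_four
  have hsub1 : Icc s0 T ⊆ Icc 0 S := Icc_subset_Icc hs0.1 hT.2
  have hsub2 : Ioo s0 T ⊆ Ioo 0 S := Ioo_subset_Ioo hs0.1 hT.2
  have key := cmc_mono_aux
    (F := fun u => Real.sin (2 * θ u) * Real.cos (α u) - δ * θ u)
    (F' := fun u => (Real.cos (2 * θ u) * (2 * (Real.sin (α u) / Real.sin (r u))) * Real.cos (α u)
        + Real.sin (2 * θ u) * (- Real.sin (α u) * alphaRHS n H (r u) (θ u) (α u)))
        - δ * (Real.sin (α u) / Real.sin (r u))) hsT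
    (((cmc_v_cont h).mono hsub1).sub (continuousOn_const.mul (h.ct.mono hsub1)))
    (fun u hu => (cmc_v_deriv hn h (hsub2 hu)).1.sub ((h.dt u (hsub2 hu)).const_mul _)) (by
      intro u hu
      have huI : u ∈ Icc 0 S := Ioo_subset_Icc_self (hsub2 hu)
      obtain ⟨q1, q2, q3, q4, q5, q6⟩ := h.signs huI
      have hd := (cmc_v_deriv hn h (hsub2 hu)).2
      have k0 : 0 ≤ - Real.sin (α u) := by linarith
      have k1 : 0 ≤ 3 * (Real.cos (r u) / Real.sin (r u)) * (- Real.sin (α u)) :=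
        mul_nonneg (by positivity) k0
      have k2 : Real.sin (2 * θ u) * (- Real.sin (α u)) * (-δ) ≤
          Real.sin (2 * θ u) * (- Real.sin (α u)) *
          (3 * (Real.cos (r u) / Real.sin (r u)) * (- Real.sin (α u)) + H) :=
        mul_le_mul_of_nonneg_left (by linarith) (mul_nonneg q3.le k0)
      have k3 : Real.sin (2 * θ u) * (- Real.sin (α u)) ≤ 1 * (- Real.sin (α u)) :=
        mul_le_mul_of_nonneg_right (Real.sin_le_one _) k0
      have k9 : - Real.sin (α u) ≤ - Real.sin (α u) / Real.sin (r u) := by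
        rw [le_div_iff₀ q1]
        nlinarith [Real.sin_le_one (r u)]
      have k10 := mul_le_mul_of_nonneg_left (k3.trans ((one_mul _).le.trans k9)) hδ
      rw [neg_div] at k10
      linarith)
  have t1 := (h.bt s0 hs0)
  have t2 := (h.bt T hT)
  nlinarith

/-- Phase B: `θ` stays bounded below. -/
lemma cmc_phaseB {n : ℕ} {H : ℝ} {r θ α : ℝ → ℝ} {ε S s0 a : ℝ}
    (h : CMCFacts n H r θ α (Real.pi / 2 - ε) S) (hs0 : s0 ∈ Icc 0 S)
    (hε : 0 < ε) (hε2 : ε ≤ 1 / 2) (ha : 0 < a) (hθ : Real.pi / 8 ≤ θ s0)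
    (hv : ∀ u ∈ Icc s0 S, a * ε ≤ Real.sin (2 * θ u) * Real.cos (α u)) :
    Real.pi / 8 * Real.exp (-(4 / a)) ≤ θ S := by
  have hp := Real.pi_pos
  have hSI := right_mem_Icc.2 h.hS.le
  have hsub1 : Icc s0 S ⊆ Icc 0 S := Icc_subset_Icc_left hs0.1
  have hsub2 : Ioo s0 S ⊆ Ioo 0 S := Ioo_subset_Ioo_left hs0.1
  have key := cmc_mono_aux
    (F := fun u => r u + a * ε / 4 * Real.log (θ u))
    (F' := fun u => Real.cos (α u)
        + a * ε / 4 * ((Real.sin (α u) / Real.sin (r u)) / θ u)) hs0.2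
    ((h.cr.mono hsub1).add (continuousOn_const.mul ((h.ct.mono hsub1).log
      (fun u hu => (h.bt u (hsub1 hu)).1.ne'))))
    (fun u hu => (h.dr u (hsub2 hu)).add (((h.dt u (hsub2 hu)).log
      (h.bt u (Ioo_subset_Icc_self (hsub2 hu))).1.ne').const_mul _)) (by
      intro u hu
      have huI : u ∈ Icc 0 S := Ioo_subset_Icc_self (hsub2 hu)
      obtain ⟨q1, q2, q3, q4, q5, q6⟩ := h.signs huI
      obtain ⟨t1, t2⟩ := h.bt u huI
      have hvu := hv u (Ioo_subset_Icc_self hu)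
      have k8 := cmc_sin_half h hε2 huI
      have k9 : - Real.sin (α u) / Real.sin (r u) ≤ 2 := by
        rw [div_le_iff₀ q1]
        nlinarith [Real.neg_one_le_sin (α u)]
      have k1 : a * ε ≤ 2 * θ u * Real.cos (α u) :=
        hvu.trans (mul_le_mul_of_nonneg_right (Real.sin_le (by linarith)) q5)
      have k2 : a * ε / 4 * ((- Real.sin (α u) / Real.sin (r u)) / θ u) ≤ a * ε / 4 * (2 / θ u) :=
        mul_le_mul_of_nonneg_left (div_le_div_of_nonneg_right k9 t1.le) (by positivity)
      have k3 : a * ε / 4 * (2 / θ u) ≤ Real.cos (α u) := by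
        rw [← mul_div_assoc, div_le_iff₀ t1]
        linarith
      have e : a * ε / 4 * ((- Real.sin (α u) / Real.sin (r u)) / θ u)
        = - (a * ε / 4 * ((Real.sin (α u) / Real.sin (r u)) / θ u)) := by ring
      linarith)
  have h1 := (h.br s0 hs0).1
  have h2 := (h.br S hSI).2
  have hl : Real.log (Real.pi / 8) ≤ Real.log (θ s0) := Real.log_le_log (by positivity) hθ
  rw [← Real.log_le_log_iff (by positivity) (h.bt S hSI).1,
    Real.log_mul (by positivity) (Real.exp_pos _).ne', Real.log_exp]
  have h3 : a * ε / 4 * (Real.log (θ s0) - Real.log (θ S)) ≤ a * ε / 4 * (4 / a) := by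
    have : a * ε / 4 * (4 / a) = ε := by field_simp
    linarith
  have h4 := le_of_mul_le_mul_left h3 (by positivity)
  linarith

lemma cmc_part_two {n : ℕ} (hn : 2 ≤ n) {H : ℝ} {r θ α : ℝ → ℝ} {ε S φ M : ℝ}
    (hφ : φ = 1 / (4 * Real.exp (n * 1 * Real.pi)))
    (hM : M = 1 / Real.sin (2 * (Real.pi / 8 * Real.exp (-(4 / (φ / 32))))))
    (hε : 0 < ε) (hε1 : ε * Real.exp (n * 1 * Real.pi) ≤ 1)
    (hε2 : ε ≤ 1 / 2) (hε3 : ε * Real.exp (n * M * Real.pi) ≤ 1)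
    (hH0 : H ≤ 0) (hH : -(φ ^ 2 * ε / 32) ≤ H)
    (hm : IsMonotoneMaximalSolution n H r θ α (Real.pi / 2 - ε) S) : r S = Real.pi / 2 := by
  have hp := Real.pi_gt_three
  have h := cmc_facts hm
  have hSI := right_mem_Icc.2 h.hS.le
  have hC1 : 1 ≤ Real.exp (n * 1 * Real.pi) := Real.one_le_exp (by positivity)
  have hφ0 : 0 < φ := by rw [hφ]; positivity
  have hφ1 : φ ≤ 1 / 4 := by
    rw [hφ]; apply one_div_le_one_div_of_le <;> linarith
  have hφε : 0 < φ * ε := by positivity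
  have hφε2 : φ * ε ≤ 1 / 4 * ε := mul_le_mul_of_nonneg_right hφ1 hε.le
  have hφ2 : φ ^ 2 * ε ≤ 1 / 4 * (φ * ε) := by
    have := mul_le_mul_of_nonneg_right hφ1 hφε.le
    nlinarith
  have hφ2' : 0 < φ ^ 2 * ε := by positivity
  -- lower bound for v
  have hv : ∀ u ∈ Icc 0 S, θ u ≤ Real.pi / 4 - φ → ∃ s0 ∈ Icc 0 S, Real.pi / 8 ≤ θ s0 ∧
      ∀ w ∈ Icc s0 S, φ / 32 * ε ≤ Real.sin (2 * θ w) * Real.cos (α w) := by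
    intro u hu hθ
    have hsub1 : Icc 0 u ⊆ Icc 0 S := Icc_subset_Icc_right hu.2
    obtain ⟨s0, hs0, hs0e⟩ : Real.pi / 4 - φ ∈ θ '' Icc 0 u := by
      apply intermediate_value_Icc' hu.1 (h.ct.mono hsub1)
      rw [h.t0]; constructor <;> linarith
    refine ⟨s0, hsub1 hs0, by linarith, ?_⟩
    intro w hw
    have h1 := cmc_vA hn h hH0 (hsub1 hs0) hε hε1 hε2 (by linarith) hφ hs0e.ge
    have h2 := cmc_vB hn h (hsub1 hs0) ⟨hs0.1.trans hw.1, hw.2⟩ hw.1 (by positivity) hH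
    rw [hs0e] at h1 h2
    linarith
  have hvu : ∀ u ∈ Icc 0 S, θ u ≤ Real.pi / 4 - φ →
      φ / 32 * ε ≤ Real.sin (2 * θ u) * Real.cos (α u) := by
    intro u hu hθ
    have hsub1 : Icc 0 u ⊆ Icc 0 S := Icc_subset_Icc_right hu.2
    obtain ⟨s0, hs0, hs0e⟩ : Real.pi / 4 - φ ∈ θ '' Icc 0 u := by
      apply intermediate_value_Icc' hu.1 (h.ct.mono hsub1)
      rw [h.t0]; constructor <;> linarith
    have h1 := cmc_vA hn h hH0 (hsub1 hs0) hε hε1 hε2 (by linarith) hφ hs0e.ge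
    have h2 := cmc_vB hn h (hsub1 hs0) hu hs0.2 (by positivity) hH
    rw [hs0e] at h1 h2
    linarith
  have hθ1 : Real.pi / 8 * Real.exp (-(4 / (φ / 32))) ≤ θ S := by
    by_cases hc : θ S ≤ Real.pi / 4 - φ
    · obtain ⟨s0, hs0, hs1, hs2⟩ := hv S hSI hc
      exact cmc_phaseB h hs0 hε hε2 (by positivity) hs1 hs2
    · push Not at hc
      have : Real.exp (-(4 / (φ / 32))) ≤ 1 := Real.exp_le_one_iff.2 (by
        have : 0 ≤ 4 / (φ / 32) := by positivity
        linarith)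
      nlinarith
  set t := Real.pi / 8 * Real.exp (-(4 / (φ / 32))) with ht
  have ht0 : 0 < t := by positivity
  have ht4 : t ≤ Real.pi / 4 := hθ1.trans (h.bt S hSI).2
  have hst : 0 < Real.sin (2 * t) := Real.sin_pos_of_pos_of_lt_pi (by linarith) (by linarith)
  have hM1 : 1 ≤ M := by
    rw [hM, le_div_iff₀ hst]
    linarith [Real.sin_le_one (2 * t)]
  have hβ : ∀ u ∈ Icc 0 S, α u + Real.pi / 2 ≤ 1 := by
    intro u hu
    refine (cmc_gronwall h hH0 hM1 hu hε hε3 ?_).trans hε3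
    intro w hw
    have hwI : w ∈ Icc 0 S := ⟨hw.1, hw.2.trans hu.2⟩
    have h1 : t ≤ θ w := hθ1.trans (h.mt hwI hSI hwI.2)
    rw [hM]
    apply div_le_div₀ zero_le_one (Real.cos_le_one _) hst
    apply Real.sin_le_sin_of_le_of_le_pi_div_two <;> linarith [(h.bt w hwI).2]
  have hk : 0 < φ ^ 2 * ε / 32 := by positivity
  rcases cmc_end hm hk (by
    intro s hs
    have hsI : s ∈ Icc 0 S := Ioo_subset_Icc_self hs
    obtain ⟨q1, q2, q3, q4, q5, q6⟩ := h.signs hsI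
    have hge := alphaRHS_ge hn (H := H) q1 q2 q3 q4 q5 q6
    have hbs := (h.ba s hsI).1
    have hβs := hβ s hsI
    have hsr := Real.sin_le_one (r s)
    have k0 : 0 ≤ - Real.sin (α s) := by linarith
    have p1 : 0 ≤ 2 * (Real.cos (2 * θ s) / Real.sin (2 * θ s)) * Real.cos (α s) / Real.sin (r s) := by
      positivity
    have p2 : 0 ≤ 3 * (Real.cos (r s) / Real.sin (r s)) * (- Real.sin (α s)) :=
      mul_nonneg (by positivity) k0
    by_cases hc : θ s ≤ Real.pi / 4 - φ
    · have hv1 := hvu s hsI hc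
      have c1 : φ / 32 * ε ≤ Real.cos (α s) := by
        have := mul_le_mul_of_nonneg_right (Real.sin_le_one (2 * θ s)) q5
        linarith
      obtain ⟨b1, b2⟩ := h.bt s hsI
      have c2 : φ ≤ Real.cos (2 * θ s) / Real.sin (2 * θ s) := by
        have := cmc_cot_ge b1 b2
        linarith
      have c3 : φ * (φ / 32 * ε) ≤ Real.cos (2 * θ s) / Real.sin (2 * θ s) * Real.cos (α s) :=
        mul_le_mul c2 c1 (by positivity) (by positivity)
      have c4 : 2 * (φ * (φ / 32 * ε)) ≤
          2 * (Real.cos (2 * θ s) / Real.sin (2 * θ s)) * Real.cos (α s) / Real.sin (r s) := by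
        rw [le_div_iff₀ q1]
        have : 2 * (φ * (φ / 32 * ε)) * Real.sin (r s) ≤ 2 * (φ * (φ / 32 * ε)) * 1 :=
          mul_le_mul_of_nonneg_left hsr (by positivity)
        linarith
      have e : 2 * (φ * (φ / 32 * ε)) = 2 * (φ ^ 2 * ε / 32) := by ring
      linarith
    · push Not at hc
      obtain ⟨A1, A2, A3⟩ := cmc_phaseA h hH0 hsI hε hε1 hφ hc.le
      have k1 : 1 / 2 ≤ - Real.sin (α s) := by
        rw [← Real.sin_neg, ← Real.sin_pi_div_six]
        apply Real.sin_le_sin_of_le_of_le_pi_div_two <;> linarith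
      have k2 : ε / 4 ≤ Real.cos (r s) := by
        rw [← Real.sin_pi_div_two_sub]
        have := (h.br s hsI)
        have := cmc_half_le_sin (x := Real.pi / 2 - r s) (by linarith) (by linarith)
        linarith
      have k3 : ε / 4 ≤ Real.cos (r s) / Real.sin (r s) := by
        rw [le_div_iff₀ q1]
        nlinarith
      have k5 : ε / 4 * (1 / 2) ≤ (Real.cos (r s) / Real.sin (r s)) * (- Real.sin (α s)) :=
        mul_le_mul k3 k1 (by norm_num) (by linarith)
      linarith) with h1 | h1
  · exact h1
  · have := hβ S hSI
    rw [h1] at this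
    linarith

/-- There exist `0 < r₀' < r₀'' < π/2` and `0 < δ < (2n−1)·cot r₀''` such that for all
`−δ ≤ H ≤ 0`, every monotone maximal solution with initial value `r₀'` ends with
`α(s∗) = 0`, and every monotone maximal solution with initial value `r₀''` ends with
`r(s∗) = π/2`. -/
theorem exists_initial_values_with_endpoint_behavior (n : ℕ) (hn : 2 ≤ n) :
    ∃ r₀' r₀'' δ : ℝ,
      0 < r₀' ∧ r₀' < r₀'' ∧ r₀'' < Real.pi / 2 ∧
      0 < δ ∧ δ < (2 * (n : ℝ) - 1) * (Real.cos r₀'' / Real.sin r₀'') ∧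
      ∀ H : ℝ, -δ ≤ H → H ≤ 0 →
        (∀ (r θ α : ℝ → ℝ) (sStar : ℝ),
          IsMonotoneMaximalSolution n H r θ α r₀' sStar → α sStar = 0) ∧
        (∀ (r θ α : ℝ → ℝ) (sStar : ℝ),
          IsMonotoneMaximalSolution n H r θ α r₀'' sStar → r sStar = Real.pi / 2) := by
  have hp := Real.pi_gt_three
  have hN : (2:ℝ) ≤ n := by exact_mod_cast hn
  obtain ⟨φ, hφ⟩ : ∃ φ : ℝ, φ = 1 / (4 * Real.exp (n * 1 * Real.pi)) := ⟨_, rfl⟩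
  obtain ⟨M, hM⟩ : ∃ M : ℝ,
    M = 1 / Real.sin (2 * (Real.pi / 8 * Real.exp (-(4 / (φ / 32))))) := ⟨_, rfl⟩
  have hC : 1 ≤ Real.exp (n * 1 * Real.pi) := Real.one_le_exp (by positivity)
  have hC1 := Real.exp_pos (n * M * Real.pi)
  obtain ⟨ε, hεd⟩ : ∃ ε : ℝ,
    ε = 1 / (Real.exp (n * 1 * Real.pi) + Real.exp (n * M * Real.pi) + 2) := ⟨_, rfl⟩
  have hε : 0 < ε := by rw [hεd]; positivity
  have hεm : ε * (Real.exp (n * 1 * Real.pi) + Real.exp (n * M * Real.pi) + 2) = 1 := by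
    rw [hεd]; field_simp
  have hε1 : ε * Real.exp (n * 1 * Real.pi) ≤ 1 := by nlinarith
  have hε2 : ε ≤ 1 / 2 := by nlinarith
  have hε3 : ε * Real.exp (n * M * Real.pi) ≤ 1 := by nlinarith
  have hφ0 : 0 < φ := by rw [hφ]; positivity
  have hφ1 : φ ≤ 1 / 4 := by
    rw [hφ]; apply one_div_le_one_div_of_le <;> linarith
  have he : Real.exp (-(8 * (n:ℝ) * Real.pi)) ≤ 1 := Real.exp_le_one_iff.2 (by
    have : 0 ≤ 8 * (n:ℝ) * Real.pi := by positivity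
    linarith)
  refine ⟨Real.pi / 4 * Real.exp (-(8 * (n:ℝ) * Real.pi)), Real.pi / 2 - ε,
    min (1 / (16 * (n:ℝ))) (φ ^ 2 * ε / 32), by positivity, by nlinarith, by linarith,
    lt_min (by positivity) (by positivity), ?_, ?_⟩
  · refine lt_of_le_of_lt (min_le_right _ _) ?_
    rw [Real.cos_pi_div_two_sub, Real.sin_pi_div_two_sub]
    have h1 : ε / 2 ≤ Real.sin ε := cmc_half_le_sin hε.le (by linarith)
    have h2 : 0 < Real.cos ε := Real.cos_pos_of_mem_Ioo ⟨by linarith, by linarith⟩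
    have h3 : ε / 2 ≤ Real.sin ε / Real.cos ε := by
      rw [le_div_iff₀ h2]
      nlinarith [Real.cos_le_one ε]
    have h4 : φ ^ 2 ≤ 1 := by nlinarith
    have h5 : 3 * (ε / 2) ≤ (2 * (n:ℝ) - 1) * (Real.sin ε / Real.cos ε) :=
      mul_le_mul (by linarith) h3 (by positivity) (by linarith)
    nlinarith
  · intro H hH hH0
    refine ⟨fun r θ α S hm => ?_, fun r θ α S hm => ?_⟩
    · exact cmc_part_one hn hH0 (by linarith [min_le_left (1 / (16 * (n:ℝ))) (φ ^ 2 * ε / 32)]) hm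
    · exact cmc_part_two hn hφ hM hε hε1 hε2 hε3 hH0
        (by linarith [min_le_right (1 / (16 * (n:ℝ))) (φ ^ 2 * ε / 32)]) hm
end
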